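/- arXiv:2312.04120 — 2 statements merged into one kernel-verified Lean document; each statement's English description precedes it below -/
import Mathlib

section
/- For every set S of positive integers of asymptotic density zero, the set 𝒰 ∪ S cannot be written as the union of finitely many infinite arithmetic progressions {m_i h + a_i : h = 0, 1, 2, …} (with m_i, a_i positive integers, 1 ≤ i ≤ t) together with a set W of positive integers of asymptotic density zero. -/
open Filter

/-- `U` is the set of positive odd integers that cannot be written as `p + 2^k`
with `p` prime and `k` a positive integer. -/
def U : Set ℕ :=
  {n | 0 < n ∧ Odd n ∧ ¬ ∃ (p k : ℕ), p.Prime ∧ 0 < k ∧ n = p + 2 ^ k}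

/-- The infinite arithmetic progression `{m*h + a : h = 0, 1, 2, ...}`. -/
def AP (m a : ℕ) : Set ℕ := {n | ∃ h : ℕ, n = m * h + a}

/-- A set of natural numbers has asymptotic density zero. -/
def DensityZero (S : Set ℕ) : Prop :=
  Tendsto (fun N : ℕ => (Nat.card ↥(S ∩ Set.Icc 1 N) : ℝ) / N) atTop (nhds 0)

section Selberg

open Finset ArithmeticFunction BoundingSieve
open scoped ArithmeticFunction.Moebius ArithmeticFunction.zeta

lemma sum_moebius_between {P l l' : ℕ} (hP : Squarefree P) (hl' : l' ∣ P) :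
    ∑ d ∈ P.divisors, (if l ∣ d ∧ d ∣ l' then (μ d : ℝ) else 0) =
      if l = l' then (μ l : ℝ) else 0 := by
  have hl'0 : l' ≠ 0 := ne_zero_of_dvd_ne_zero hP.ne_zero hl'
  by_cases h : l ∣ l'
  · obtain ⟨c, rfl⟩ := h
    have hl0 : l ≠ 0 := left_ne_zero_of_mul hl'0
    have hc0 : c ≠ 0 := right_ne_zero_of_mul hl'0
    have hset : P.divisors.filter (fun d => l ∣ d ∧ d ∣ l * c) = c.divisors.image (l * ·) := by
      ext d
      simp only [mem_filter, Nat.mem_divisors, mem_image]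
      constructor
      · rintro ⟨-, ⟨e, rfl⟩, h2⟩
        exact ⟨e, ⟨Nat.dvd_of_mul_dvd_mul_left (Nat.pos_of_ne_zero hl0) h2, hc0⟩, rfl⟩
      · rintro ⟨e, ⟨he, -⟩, rfl⟩
        have := Nat.mul_dvd_mul_left l he
        exact ⟨⟨this.trans hl', hP.ne_zero⟩, Nat.dvd_mul_right _ _, this⟩
    rw [← sum_filter, hset, sum_image
      (fun a _ b _ hab => Nat.eq_of_mul_eq_mul_left (Nat.pos_of_ne_zero hl0) hab)]
    have hcop : l.Coprime c := Nat.coprime_of_squarefree_mul (hP.squarefree_of_dvd hl')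
    have h1 : ∀ e ∈ c.divisors, (μ (l * e) : ℝ) = μ l * μ e := by
      intro e he
      rw [isMultiplicative_moebius.map_mul_of_coprime
        (hcop.coprime_dvd_right (Nat.dvd_of_mem_divisors he))]
      push_cast; rfl
    rw [sum_congr rfl h1, ← mul_sum]
    have h2 : (∑ e ∈ c.divisors, (μ e : ℝ)) = if c = 1 then 1 else 0 := by
      have := congrArg (fun f : ArithmeticFunction ℤ => f c) coe_zeta_mul_moebius
      simp only [coe_zeta_mul_apply, one_apply] at this
      exact_mod_cast this
    rw [h2]
    have : l = l * c ↔ c = 1 := by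
      constructor
      · intro h; exact Nat.eq_of_mul_eq_mul_left (Nat.pos_of_ne_zero hl0) (by omega)
      · rintro rfl; simp
    simp only [this]
    split_ifs <;> simp
  · rw [if_neg fun hh : l = l' => h hh.dvd]
    refine sum_eq_zero fun d _ => if_neg fun hd => h (hd.1.trans hd.2)

variable (s : BoundingSieve) (R : ℕ)

/-- The normalising sum in Selberg's sieve of level `R ^ 2`. -/
noncomputable def selbergSum : ℝ :=
  ∑ l ∈ s.prodPrimes.divisors, if l ≤ R then s.selbergTerms l else 0

/-- The optimal weights in Selberg's sieve of level `R ^ 2`. -/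
noncomputable def selbergWeights (d : ℕ) : ℝ :=
  (s.nu d)⁻¹ * μ d * ((selbergSum s R)⁻¹ *
    ∑ l ∈ s.prodPrimes.divisors, if d ∣ l ∧ l ≤ R then s.selbergTerms l else 0)

variable {s R}

lemma selbergTerms_nonneg_of_mem {l : ℕ} (hl : l ∈ s.prodPrimes.divisors) :
    0 ≤ s.selbergTerms l := (selbergTerms_pos (Nat.dvd_of_mem_divisors hl)).le

lemma one_le_selbergSum (hR : 1 ≤ R) : 1 ≤ selbergSum s R := by
  have h1 : (1 : ℕ) ∈ s.prodPrimes.divisors := Nat.one_mem_divisors.mpr prodPrimes_ne_zero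
  have := single_le_sum (f := fun l => if l ≤ R then s.selbergTerms l else 0)
    (fun l hl => by
      split_ifs
      exacts [selbergTerms_nonneg_of_mem hl, le_rfl]) h1
  simpa [hR, selbergTerms_isMultiplicative.map_one, selbergSum] using this

lemma selbergWeights_one (hR : 1 ≤ R) : selbergWeights s R 1 = 1 := by
  have h := one_le_selbergSum (s := s) hR
  simp only [selbergWeights, s.nu_mult.map_one, inv_one, moebius_apply_one, Int.cast_one, one_mul,
    one_dvd, true_and]
  exact inv_mul_cancel₀ (by linarith)

lemma selbergWeights_eq_zero {d : ℕ} (hd : R < d) : selbergWeights s R d = 0 := by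
  rw [selbergWeights, sum_eq_zero, mul_zero, mul_zero]
  intro l hl
  refine if_neg fun h => ?_
  exact absurd (Nat.le_of_dvd (Nat.pos_of_mem_divisors hl) h.1) (by omega)

lemma abs_selbergWeights_le (hR : 1 ≤ R) {d : ℕ} (hd : d ∣ s.prodPrimes) :
    |selbergWeights s R d| ≤ (s.nu d)⁻¹ := by
  have h := one_le_selbergSum (s := s) hR
  have hnu := nu_pos_of_dvd_prodPrimes hd
  have h0 : 0 ≤ ∑ l ∈ s.prodPrimes.divisors, if d ∣ l ∧ l ≤ R then s.selbergTerms l else 0 :=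
    sum_nonneg fun l hl => by
      split_ifs
      exacts [selbergTerms_nonneg_of_mem hl, le_rfl]
  have h1 : (∑ l ∈ s.prodPrimes.divisors, if d ∣ l ∧ l ≤ R then s.selbergTerms l else 0) ≤
      selbergSum s R := by
    refine sum_le_sum fun l hl => ?_
    have := selbergTerms_nonneg_of_mem hl
    split_ifs <;> first | exact le_rfl | exact this | (exfalso; tauto)
  have h2 : |(selbergSum s R)⁻¹ *
      ∑ l ∈ s.prodPrimes.divisors, if d ∣ l ∧ l ≤ R then s.selbergTerms l else 0| ≤ 1 := by
    rw [abs_of_nonneg (by positivity), inv_mul_le_iff₀ (by linarith)]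
    linarith
  have h3 : |(μ d : ℝ)| ≤ 1 := by exact_mod_cast abs_moebius_le_one
  rw [selbergWeights, abs_mul, abs_mul, abs_of_pos (inv_pos.mpr hnu)]
  calc _ ≤ (s.nu d)⁻¹ * 1 * 1 := by gcongr
    _ = _ := by ring

lemma sum_nu_mul_selbergWeights {l : ℕ} (hl : l ∣ s.prodPrimes) :
    (∑ d ∈ s.prodPrimes.divisors, if l ∣ d then s.nu d * selbergWeights s R d else 0) =
      if l ≤ R then (selbergSum s R)⁻¹ * μ l * s.selbergTerms l else 0 := by
  have h1 : ∀ d ∈ s.prodPrimes.divisors,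
      (if l ∣ d then s.nu d * selbergWeights s R d else 0) =
      ∑ l' ∈ s.prodPrimes.divisors, (if l' ≤ R then (selbergSum s R)⁻¹ * s.selbergTerms l' else 0) *
        (if l ∣ d ∧ d ∣ l' then (μ d : ℝ) else 0) := by
    intro d hd
    have hnu := (nu_pos_of_dvd_prodPrimes (s := s) (Nat.dvd_of_mem_divisors hd)).ne'
    split_ifs with h
    · rw [selbergWeights, mul_assoc (s.nu d)⁻¹, mul_inv_cancel_left₀ hnu, mul_sum, mul_sum]
      refine sum_congr rfl fun l' _ => ?_
      by_cases h1 : d ∣ l' <;> by_cases h2 : l' ≤ R <;> (simp [h1, h2, h]; try ring)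
    · simp [h]
  rw [sum_congr rfl h1, sum_comm]
  simp_rw [← mul_sum]
  have h2 : ∀ l' ∈ s.prodPrimes.divisors,
      (if l' ≤ R then (selbergSum s R)⁻¹ * s.selbergTerms l' else 0) *
        ∑ d ∈ s.prodPrimes.divisors, (if l ∣ d ∧ d ∣ l' then (μ d : ℝ) else 0) =
      if l = l' then (if l ≤ R then (selbergSum s R)⁻¹ * μ l * s.selbergTerms l else 0) else 0 := by
    intro l' hl'
    rw [sum_moebius_between s.prodPrimes_squarefree (Nat.dvd_of_mem_divisors hl')]
    by_cases h : l = l'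
    · subst h
      simp only [if_true]
      split_ifs <;> ring
    · simp [h]
  rw [sum_congr rfl h2, sum_ite_eq, if_pos (Nat.mem_divisors.mpr ⟨hl, prodPrimes_ne_zero⟩)]

lemma mainSum_selbergWeights (hR : 1 ≤ R) :
    s.mainSum (lambdaSquared (selbergWeights s R)) = (selbergSum s R)⁻¹ := by
  have h := one_le_selbergSum (s := s) hR
  rw [mainSum_lambdaSquared_eq_sum_mul_sum_sq]
  have h1 : ∀ l ∈ s.prodPrimes.divisors, (s.selbergTerms l)⁻¹ *
      (∑ d ∈ s.prodPrimes.divisors, if l ∣ d then s.nu d * selbergWeights s R d else 0) ^ 2 =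
      ((selbergSum s R)⁻¹) ^ 2 * if l ≤ R then s.selbergTerms l else 0 := by
    intro l hl
    have hlP := Nat.dvd_of_mem_divisors hl
    have hg := (selbergTerms_pos (s := s) hlP).ne'
    have hmu : (μ l : ℝ) ^ 2 = 1 := by
      exact_mod_cast moebius_sq_eq_one_of_squarefree (s.prodPrimes_squarefree.squarefree_of_dvd hlP)
    rw [sum_nu_mul_selbergWeights hlP]
    split_ifs
    · rw [mul_pow, mul_pow, hmu]
      field_simp
    · simp
  rw [sum_congr rfl h1, ← mul_sum]
  change _ * selbergSum s R = _
  field_simp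

lemma errSum_selbergWeights_le (hR : 1 ≤ R)
    (hrem : ∀ d, d ∣ s.prodPrimes → |s.rem d| ≤ d)
    (hnu : ∀ d, d ∣ s.prodPrimes → (s.nu d)⁻¹ ≤ d) :
    s.errSum (lambdaSquared (selbergWeights s R)) ≤ (R : ℝ) ^ 6 := by
  set w := selbergWeights s R
  set P := s.prodPrimes
  calc s.errSum (lambdaSquared w)
      ≤ ∑ d ∈ P.divisors, ∑ d1 ∈ P.divisors, ∑ d2 ∈ P.divisors,
          if d = d1.lcm d2 then |w d1| * |w d2| * |s.rem d| else 0 := by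
        refine sum_le_sum fun d hd => ?_
        have hsub : d.divisors ⊆ P.divisors :=
          Nat.divisors_subset_of_dvd prodPrimes_ne_zero (Nat.dvd_of_mem_divisors hd)
        have h1 : |lambdaSquared w d| ≤ ∑ d1 ∈ P.divisors, ∑ d2 ∈ P.divisors,
            if d = d1.lcm d2 then |w d1| * |w d2| else 0 := by
          refine (abs_sum_le_sum_abs _ _).trans ?_
          refine (sum_le_sum_of_subset_of_nonneg hsub fun _ _ _ => abs_nonneg _).trans ?_
          refine sum_le_sum fun d1 _ => ?_
          refine (abs_sum_le_sum_abs _ _).trans ?_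
          refine (sum_le_sum_of_subset_of_nonneg hsub fun _ _ _ => abs_nonneg _).trans ?_
          refine sum_le_sum fun d2 _ => ?_
          split_ifs <;> simp [abs_mul]
        refine (mul_le_mul_of_nonneg_right h1 (abs_nonneg _)).trans (le_of_eq ?_)
        simp_rw [sum_mul, ite_mul, zero_mul]
    _ = ∑ d1 ∈ P.divisors, ∑ d2 ∈ P.divisors, |w d1| * |w d2| * |s.rem (d1.lcm d2)| := by
        rw [sum_comm]
        refine sum_congr rfl fun d1 hd1 => ?_
        rw [sum_comm]
        refine sum_congr rfl fun d2 hd2 => ?_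
        rw [sum_ite_eq' P.divisors, if_pos]
        exact Nat.mem_divisors.mpr ⟨Nat.lcm_dvd (Nat.dvd_of_mem_divisors hd1)
          (Nat.dvd_of_mem_divisors hd2), prodPrimes_ne_zero⟩
    _ ≤ ∑ d1 ∈ P.divisors, ∑ d2 ∈ P.divisors,
          (if d1 ≤ R then (R : ℝ) ^ 2 else 0) * (if d2 ≤ R then (R : ℝ) ^ 2 else 0) := by
        have hw : ∀ d ∈ P.divisors, |w d| * d ≤ if d ≤ R then (R : ℝ) ^ 2 else 0 := by
          intro d hd
          have hdP := Nat.dvd_of_mem_divisors hd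
          split_ifs with h
          · have h1 : |w d| ≤ R := ((abs_selbergWeights_le hR hdP).trans (hnu d hdP)).trans
              (by exact_mod_cast h)
            have h2 : (d : ℝ) ≤ R := by exact_mod_cast h
            rw [sq]
            gcongr
          · rw [show w d = 0 from selbergWeights_eq_zero (by omega)]
            simp
        refine sum_le_sum fun d1 hd1 => sum_le_sum fun d2 hd2 => ?_
        have h1 : |s.rem (d1.lcm d2)| ≤ (d1 : ℝ) * d2 := by
          refine (hrem _ (Nat.lcm_dvd (Nat.dvd_of_mem_divisors hd1)
            (Nat.dvd_of_mem_divisors hd2))).trans ?_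
          exact_mod_cast Nat.le_of_dvd (Nat.mul_pos (Nat.pos_of_mem_divisors hd1)
            (Nat.pos_of_mem_divisors hd2)) (Nat.lcm_dvd_mul d1 d2)
        calc |w d1| * |w d2| * |s.rem (d1.lcm d2)| ≤ |w d1| * |w d2| * ((d1 : ℝ) * d2) := by gcongr
          _ = (|w d1| * d1) * (|w d2| * d2) := by ring
          _ ≤ _ := mul_le_mul (hw d1 hd1) (hw d2 hd2) (by positivity) (by split_ifs <;> positivity)
    _ = (∑ d ∈ P.divisors, if d ≤ R then (R : ℝ) ^ 2 else 0) ^ 2 := by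
        rw [pow_two (∑ d ∈ P.divisors, _), sum_mul_sum]
    _ ≤ ((R : ℝ) * R ^ 2) ^ 2 := by
        gcongr
        rw [← sum_filter, sum_const, nsmul_eq_mul]
        gcongr
        have : P.divisors.filter (· ≤ R) ⊆ Icc 1 R := by
          intro d hd
          rw [mem_filter] at hd
          exact mem_Icc.mpr ⟨Nat.pos_of_mem_divisors hd.1, hd.2⟩
        simpa using card_le_card this
    _ = (R : ℝ) ^ 6 := by ring

theorem siftedSum_le_selberg (hR : 1 ≤ R)
    (hrem : ∀ d, d ∣ s.prodPrimes → |s.rem d| ≤ d)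
    (hnu : ∀ d, d ∣ s.prodPrimes → (s.nu d)⁻¹ ≤ d) :
    s.siftedSum ≤ s.totalMass / selbergSum s R + (R : ℝ) ^ 6 := by
  have h := siftedSum_le_mainSum_errSum_of_upperMoebius _
    (upperMoebius_lambdaSquared (selbergWeights s R) (selbergWeights_one hR)) (s := s)
  rw [mainSum_selbergWeights hR] at h
  rw [div_eq_mul_inv]
  linarith [errSum_selbergWeights_le hR hrem hnu]

end Selberg

section Sieve

open Finset ArithmeticFunction BoundingSieve

/-- The number of residues `n` modulo `d` with `d ∣ f n`. -/
def rootCount (f : ℕ → ℕ) (d : ℕ) : ℕ := #{n ∈ range d | d ∣ f n}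

/-- `f` respects all congruences, as polynomials do. -/
def RespectsModEq (f : ℕ → ℕ) : Prop := ∀ d x y : ℕ, x ≡ y [MOD d] → f x ≡ f y [MOD d]

lemma RespectsModEq.dvd_iff {f : ℕ → ℕ} (hf : RespectsModEq f) {d x y : ℕ} (h : x ≡ y [MOD d]) :
    d ∣ f x ↔ d ∣ f y := (hf d x y h).dvd_iff dvd_rfl

lemma rootCount_le (f : ℕ → ℕ) (d : ℕ) : rootCount f d ≤ d := by
  simpa [rootCount] using card_filter_le (range d) (fun n => d ∣ f n)

lemma rootCount_one (f : ℕ → ℕ) : rootCount f 1 = 1 := by simp [rootCount]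

lemma rootCount_mul {f : ℕ → ℕ} (hf : RespectsModEq f) {a b : ℕ} (hab : a.Coprime b)
    (ha : a ≠ 0) (hb : b ≠ 0) : rootCount f (a * b) = rootCount f a * rootCount f b := by
  rw [rootCount, rootCount, rootCount, ← card_product]
  refine card_bij (fun n _ => (n % a, n % b)) ?_ ?_ ?_
  · intro n hn
    simp only [mem_filter, mem_range, mem_product] at hn ⊢
    refine ⟨⟨Nat.mod_lt _ (Nat.pos_of_ne_zero ha), ?_⟩, Nat.mod_lt _ (Nat.pos_of_ne_zero hb), ?_⟩
    · exact (hf.dvd_iff (Nat.mod_modEq n a)).mpr ((Nat.dvd_mul_right a b).trans hn.2)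
    · exact (hf.dvd_iff (Nat.mod_modEq n b)).mpr ((Nat.dvd_mul_left b a).trans hn.2)
  · intro n hn m hm h
    simp only [mem_filter, mem_range, Prod.mk.injEq] at hn hm h
    have : n ≡ m [MOD a * b] := (Nat.modEq_and_modEq_iff_modEq_mul hab).mp ⟨h.1, h.2⟩
    rwa [Nat.ModEq, Nat.mod_eq_of_lt hn.1, Nat.mod_eq_of_lt hm.1] at this
  · rintro ⟨x, y⟩ hxy
    simp only [mem_filter, mem_range, mem_product] at hxy
    obtain ⟨z, hz1, hz2⟩ := Nat.chineseRemainder hab x y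
    refine ⟨z % (a * b), ?_, ?_⟩
    · simp only [mem_filter, mem_range]
      refine ⟨Nat.mod_lt _ (by positivity), (hf.dvd_iff (Nat.mod_modEq z (a * b))).mpr ?_⟩
      exact hab.mul_dvd_of_dvd_of_dvd ((hf.dvd_iff hz1).mpr hxy.1.2) ((hf.dvd_iff hz2).mpr hxy.2.2)
    · simp only [Nat.mod_mul_right_mod, Nat.mod_mul_left_mod, Prod.mk.injEq]
      exact ⟨Eq.trans hz1 (Nat.mod_eq_of_lt hxy.1.1), Eq.trans hz2 (Nat.mod_eq_of_lt hxy.2.1)⟩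

/-- The proportion of integers `n` with `d ∣ f n`. -/
noncomputable def rootDensity (f : ℕ → ℕ) : ArithmeticFunction ℝ :=
  ⟨fun d => (rootCount f d : ℝ) / d, by simp⟩

lemma rootDensity_apply (f : ℕ → ℕ) (d : ℕ) : rootDensity f d = (rootCount f d : ℝ) / d := rfl

lemma rootDensity_isMultiplicative {f : ℕ → ℕ} (hf : RespectsModEq f) :
    (rootDensity f).IsMultiplicative := by
  rw [ArithmeticFunction.IsMultiplicative.iff_ne_zero]
  refine ⟨by simp [rootDensity_apply, rootCount_one], fun {m n} hm hn hmn => ?_⟩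
  simp only [rootDensity_apply, rootCount_mul hf hmn hm hn]
  push_cast
  rw [div_mul_div_comm]

lemma count_mul_dvd {f : ℕ → ℕ} (hf : RespectsModEq f) (d q : ℕ) :
    Nat.count (fun n => d ∣ f n) (d * q) = q * rootCount f d := by
  induction q with
  | zero => simp
  | succ q ih =>
    rw [mul_add, mul_one, Nat.count_add, ih, add_mul, one_mul, Nat.count_eq_card_filter_range,
      rootCount]
    congr 2
    refine filter_congr fun n _ => hf.dvd_iff ?_
    simp [Nat.ModEq]

lemma abs_count_dvd_sub_le {f : ℕ → ℕ} (hf : RespectsModEq f) {d : ℕ} (hd : d ≠ 0) (N : ℕ) :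
    |(Nat.count (fun n => d ∣ f n) N : ℝ) - rootDensity f d * N| ≤ d := by
  have hN : d * (N / d) + N % d = N := Nat.div_add_mod N d
  obtain ⟨x, hx, hxc⟩ : ∃ x, Nat.count (fun n => d ∣ f n) N = N / d * rootCount f d + x ∧
      x ≤ rootCount f d := by
    refine ⟨Nat.count (fun n => d ∣ f (d * (N / d) + n)) (N % d), ?_, ?_⟩
    · conv_lhs => rw [← hN]
      rw [Nat.count_add, count_mul_dvd hf]
    · have h1 : Nat.count (fun n => d ∣ f (d * (N / d) + n)) (N % d) =
          Nat.count (fun n => d ∣ f n) (N % d) := by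
        rw [Nat.count_eq_card_filter_range, Nat.count_eq_card_filter_range]
        congr 1
        refine filter_congr fun n _ => hf.dvd_iff ?_
        simp [Nat.ModEq]
      rw [h1, rootCount, ← Nat.count_eq_card_filter_range]
      exact Nat.count_monotone _ (Nat.mod_lt _ (Nat.pos_of_ne_zero hd)).le
  have hcd : (rootCount f d : ℝ) ≤ d := by exact_mod_cast rootCount_le f d
  have hd0 : (0 : ℝ) < d := by exact_mod_cast Nat.pos_of_ne_zero hd
  have hr : ((N % d : ℕ) : ℝ) ≤ d := by exact_mod_cast (Nat.mod_lt _ (Nat.pos_of_ne_zero hd)).le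
  have hNr : (N : ℝ) = d * ((N / d : ℕ) : ℝ) + ((N % d : ℕ) : ℝ) := by exact_mod_cast hN.symm
  have hxr : (x : ℝ) ≤ rootCount f d := by exact_mod_cast hxc
  have hc0 : (0 : ℝ) ≤ rootCount f d := by positivity
  have hkey : (Nat.count (fun n => d ∣ f n) N : ℝ) - rootDensity f d * N =
      x - rootCount f d * (((N % d : ℕ) : ℝ) / d) := by
    rw [hx, rootDensity_apply, hNr]
    push_cast
    field_simp
    ring
  have h1 : ((N % d : ℕ) : ℝ) / d ≤ 1 := (div_le_one hd0).mpr hr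
  have h2 : (0 : ℝ) ≤ ((N % d : ℕ) : ℝ) / d := by positivity
  have h3 : (0 : ℝ) ≤ x := by positivity
  rw [hkey, abs_le]
  constructor <;> nlinarith

/-- The sum of `∏ p ∣ n, k p` over squarefree `n ≤ R`. -/
noncomputable def squarefreeSum (k : ℕ → ℝ) (R : ℕ) : ℝ :=
  ∑ n ∈ Icc 1 R with Squarefree n, ∏ p ∈ n.primeFactors, k p

lemma one_le_squarefreeSum {k : ℕ → ℝ} (hk : ∀ p, 0 ≤ k p) {R : ℕ} (hR : 1 ≤ R) :
    1 ≤ squarefreeSum k R := by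
  have h := single_le_sum (s := {n ∈ Icc 1 R | Squarefree n})
    (f := fun n => ∏ p ∈ n.primeFactors, k p) (fun n _ => prod_nonneg fun p _ => hk p)
    (a := 1) (by simp [hR])
  simpa [squarefreeSum] using h

/-- Selberg's upper bound sieve for the values of a polynomial-like function. -/
theorem card_sifted_le {f : ℕ → ℕ} (hf : RespectsModEq f) (hinj : Function.Injective f)
    {k : ℕ → ℝ} (hk0 : ∀ p, 0 ≤ k p) {R : ℕ} (hR : 1 ≤ R)
    (hk : ∀ p, p.Prime → p ≤ R → k p ≠ 0 → k p ≤ (rootCount f p : ℝ) / p ∧ rootCount f p < p)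
    {A : Finset ℕ} {N : ℕ} (hAN : A ⊆ range N)
    (hA : ∀ n ∈ A, ∀ p, p.Prime → p ≤ R → ¬ p ∣ f n) :
    (#A : ℝ) ≤ N / squarefreeSum k R + (R : ℝ) ^ 6 := by
  set T : Finset ℕ := {p ∈ Icc 1 R | p.Prime ∧ k p ≠ 0} with hT
  have hTp : ∀ p ∈ T, p.Prime := fun p hp => (mem_filter.mp hp).2.1
  have hPsq : Squarefree (∏ p ∈ T, p) := by
    refine Finset.squarefree_prod_of_pairwise_isCoprime ?_ fun p hp => (hTp p hp).squarefree
    intro p hp q hq hpq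
    exact Nat.coprime_iff_isRelPrime.mp ((Nat.coprime_primes (hTp p hp) (hTp q hq)).mpr hpq)
  have hdvdT : ∀ p, p.Prime → p ∣ ∏ q ∈ T, q → p ∈ T := by
    intro p hp hpd
    obtain ⟨q, hq, hpq⟩ := (hp.prime.dvd_finsetProd_iff _).mp hpd
    rwa [(Nat.prime_dvd_prime_iff_eq hp (hTp q hq)).mp hpq]
  have hTk : ∀ p ∈ T, 0 < k p ∧ k p ≤ rootDensity f p ∧ rootDensity f p < 1 := by
    intro p hp
    have h := mem_filter.mp hp
    obtain ⟨h1, h2⟩ := hk p h.2.1 (mem_Icc.mp h.1).2 h.2.2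
    refine ⟨lt_of_le_of_ne (hk0 p) h.2.2.symm, h1, ?_⟩
    rw [rootDensity_apply, div_lt_one (by exact_mod_cast h.2.1.pos)]
    exact_mod_cast h2
  let s : BoundingSieve :=
    { support := (range N).image f
      prodPrimes := ∏ p ∈ T, p
      prodPrimes_squarefree := hPsq
      weights := fun _ => 1
      weights_nonneg := fun _ => zero_le_one
      totalMass := N
      nu := rootDensity f
      nu_mult := rootDensity_isMultiplicative hf
      nu_pos_of_prime := fun p hp hpd => by
        have := hTk p (hdvdT p hp hpd)
        linarith
      nu_lt_one_of_prime := fun p hp hpd => (hTk p (hdvdT p hp hpd)).2.2 }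
  have hP0 : s.prodPrimes ≠ 0 := prodPrimes_ne_zero
  have hrem : ∀ d, d ∣ s.prodPrimes → |s.rem d| ≤ d := by
    intro d hd
    have hd0 : d ≠ 0 := ne_zero_of_dvd_ne_zero hP0 hd
    have hms : s.multSum d = (Nat.count (fun n => d ∣ f n) N : ℝ) := by
      simp only [multSum, s]
      rw [sum_image hinj.injOn, ← sum_filter, sum_const, nsmul_eq_mul, mul_one,
        Nat.count_eq_card_filter_range]
    rw [rem, hms]
    exact abs_count_dvd_sub_le hf hd0 N
  have hnu : ∀ d, d ∣ s.prodPrimes → (s.nu d)⁻¹ ≤ d := by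
    intro d hd
    have hpos := nu_pos_of_dvd_prodPrimes hd
    change 0 < (rootCount f d : ℝ) / d at hpos
    change ((rootCount f d : ℝ) / d)⁻¹ ≤ d
    have hc : (1 : ℝ) ≤ rootCount f d := by
      rcases Nat.eq_zero_or_pos (rootCount f d) with h | h
      · simp [h] at hpos
      · exact_mod_cast h
    rw [inv_div]
    exact div_le_self (by positivity) hc
  have hmain := siftedSum_le_selberg hR hrem hnu
  have hsift : (#A : ℝ) ≤ s.siftedSum := by
    simp only [siftedSum, s]
    rw [sum_image hinj.injOn, ← sum_filter, sum_const, nsmul_eq_mul, mul_one]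
    have hsub : A ⊆ {n ∈ range N | (∏ p ∈ T, p).Coprime (f n)} := by
      intro n hn
      rw [mem_filter]
      refine ⟨hAN hn, Nat.Coprime.prod_left fun p hp => ?_⟩
      exact ((hTp p hp).coprime_iff_not_dvd).mpr
        (hA n hn p (hTp p hp) (mem_Icc.mp (mem_filter.mp hp).1).2)
    exact_mod_cast card_le_card hsub
  have hS : squarefreeSum k R ≤ selbergSum s R := by
    rw [squarefreeSum, selbergSum, ← sum_filter]
    have hsub : {d ∈ s.prodPrimes.divisors | d ≤ R} ⊆ {n ∈ Icc 1 R | Squarefree n} := by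
      intro d hd
      rw [mem_filter] at hd ⊢
      exact ⟨mem_Icc.mpr ⟨Nat.pos_of_mem_divisors hd.1, hd.2⟩,
        hPsq.squarefree_of_dvd (Nat.dvd_of_mem_divisors hd.1)⟩
    rw [← sum_subset hsub]
    · refine sum_le_sum fun d hd => ?_
      have hdP : d ∣ s.prodPrimes := Nat.dvd_of_mem_divisors (mem_filter.mp hd).1
      rw [selbergTerms_apply, ← prod_primeFactors_nu hdP, ← prod_mul_distrib]
      refine prod_le_prod (fun p _ => hk0 p) fun p hp => ?_
      have hpT := hdvdT p (Nat.prime_of_mem_primeFactors hp)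
        ((Nat.dvd_of_mem_primeFactors hp).trans hdP)
      obtain ⟨h1, h2, h3⟩ := hTk p hpT
      change k p ≤ rootDensity f p * (1 - rootDensity f p)⁻¹
      rw [← div_eq_mul_inv, le_div_iff₀ (by linarith)]
      nlinarith
    · intro n hn hnd
      rw [mem_filter, mem_Icc] at hn
      by_contra hne
      have hall : ∀ p ∈ n.primeFactors, p ∈ T := by
        intro p hp
        refine mem_filter.mpr ⟨mem_Icc.mpr ⟨(Nat.prime_of_mem_primeFactors hp).one_le,
          (Nat.le_of_mem_primeFactors hp).trans hn.1.2⟩, Nat.prime_of_mem_primeFactors hp, ?_⟩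
        exact fun h0 => hne (prod_eq_zero hp h0)
      apply hnd
      refine mem_filter.mpr ⟨Nat.mem_divisors.mpr ⟨?_, hP0⟩, hn.1.2⟩
      rw [← Nat.prod_primeFactors_of_squarefree hn.2]
      exact prod_dvd_prod_of_subset _ _ _ hall
  have h1 := one_le_squarefreeSum hk0 hR
  refine (hsift.trans hmain).trans ?_
  change (N : ℝ) / selbergSum s R + _ ≤ _
  gcongr

end Sieve

section SquarefreeSums

open Finset

/-- `∏ (1 + 1 / p)` over the primes `p` dividing `n`. -/
noncomputable def primeRatio (n : ℕ) : ℝ := ∏ p ∈ n.primeFactors, (1 + 1 / (p : ℝ))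

lemma one_le_primeRatio (n : ℕ) : 1 ≤ primeRatio n := by
  calc (1 : ℝ) = ∏ _p ∈ n.primeFactors, 1 := by simp
    _ ≤ _ := prod_le_prod (fun _ _ => zero_le_one) fun p _ => by
        have : (0 : ℝ) ≤ 1 / p := by positivity
        linarith

lemma prod_primeFactors_add {k l : ℕ → ℝ} {n : ℕ} (hn : Squarefree n) :
    ∏ p ∈ n.primeFactors, (k p + l p) =
      ∑ x ∈ n.divisorsAntidiagonal,
        (∏ p ∈ x.1.primeFactors, k p) * ∏ p ∈ x.2.primeFactors, l p := by
  have happ : ∀ (u : ℕ → ℝ) {m : ℕ}, m ≠ 0 →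
      ArithmeticFunction.prodPrimeFactors u m = ∏ p ∈ m.primeFactors, u p := fun u _ hm =>
    ArithmeticFunction.prodPrimeFactors_apply hm
  have hprime : ∀ (u : ℕ → ℝ) {p : ℕ}, p.Prime →
      ArithmeticFunction.prodPrimeFactors u p = u p := fun u p hp => by
    rw [happ u hp.ne_zero, hp.primeFactors, prod_singleton]
  have h := ArithmeticFunction.IsMultiplicative.prodPrimeFactors_add_of_squarefree
    (ArithmeticFunction.IsMultiplicative.prodPrimeFactors k)
    (ArithmeticFunction.IsMultiplicative.prodPrimeFactors l) hn
  rw [happ _ hn.ne_zero, ArithmeticFunction.mul_apply] at h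
  calc _ = _ := prod_congr rfl fun p hp => by
        have hpp := Nat.prime_of_mem_primeFactors hp
        rw [ArithmeticFunction.add_apply, hprime k hpp, hprime l hpp]
    _ = _ := h
    _ = _ := sum_congr rfl fun x hx => by
        have hx0 := Nat.ne_zero_of_mem_divisorsAntidiagonal hx
        rw [happ k hx0.1, happ l hx0.2]

/-- Pairs `(a, b)` with `a * b ≤ R` squarefree. -/
def squarefreePairs (R : ℕ) : Finset (ℕ × ℕ) :=
  {n ∈ Icc 1 R | Squarefree n}.biUnion Nat.divisorsAntidiagonal

lemma mem_squarefreePairs {R : ℕ} {x : ℕ × ℕ} :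
    x ∈ squarefreePairs R ↔ x.1 * x.2 ≤ R ∧ Squarefree (x.1 * x.2) := by
  simp only [squarefreePairs, mem_biUnion, mem_filter, mem_Icc, Nat.mem_divisorsAntidiagonal]
  constructor
  · rintro ⟨n, ⟨⟨_, h2⟩, h3⟩, rfl, -⟩
    exact ⟨h2, h3⟩
  · rintro ⟨h1, h2⟩
    exact ⟨_, ⟨⟨Nat.pos_of_ne_zero h2.ne_zero, h1⟩, h2⟩, rfl, h2.ne_zero⟩

lemma squarefreeSum_add (k l : ℕ → ℝ) (R : ℕ) :
    squarefreeSum (fun p => k p + l p) R =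
      ∑ x ∈ squarefreePairs R, (∏ p ∈ x.1.primeFactors, k p) * ∏ p ∈ x.2.primeFactors, l p := by
  rw [squarefreeSum, squarefreePairs, sum_biUnion]
  · exact sum_congr rfl fun n hn => prod_primeFactors_add (mem_filter.mp hn).2
  · intro a _ b _ hab
    refine Finset.disjoint_left.mpr fun x hx hx' => hab ?_
    rw [← (Nat.mem_divisorsAntidiagonal.mp hx).1, ← (Nat.mem_divisorsAntidiagonal.mp hx').1]

lemma squarefreeSum_add_le {k l : ℕ → ℝ} (hk : ∀ p, 0 ≤ k p) (hl : ∀ p, 0 ≤ l p) (R : ℕ) :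
    squarefreeSum (fun p => k p + l p) R ≤ squarefreeSum k R * squarefreeSum l R := by
  rw [squarefreeSum_add, squarefreeSum, squarefreeSum, sum_mul_sum, ← sum_product']
  refine sum_le_sum_of_subset_of_nonneg ?_ fun x _ _ =>
    mul_nonneg (prod_nonneg fun p _ => hk p) (prod_nonneg fun p _ => hl p)
  intro x hx
  obtain ⟨h1, h2⟩ := mem_squarefreePairs.mp hx
  have h3 := left_ne_zero_of_mul h2.ne_zero
  have h4 := right_ne_zero_of_mul h2.ne_zero
  simp only [mem_product, mem_filter, mem_Icc]
  exact ⟨⟨⟨Nat.pos_of_ne_zero h3, (Nat.le_mul_of_pos_right _ (Nat.pos_of_ne_zero h4)).trans h1⟩,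
    h2.of_mul_left⟩, ⟨Nat.pos_of_ne_zero h4,
      (Nat.le_mul_of_pos_left _ (Nat.pos_of_ne_zero h3)).trans h1⟩, h2.of_mul_right⟩

lemma squarefreeSum_le_primeRatio {h : ℕ} (hh : h ≠ 0) (R : ℕ) :
    squarefreeSum (fun p => if p ∣ h then 1 / (p : ℝ) else 0) R ≤ primeRatio h := by
  rw [primeRatio, prod_one_add, squarefreeSum]
  have h1 : ∀ n ∈ {n ∈ Icc 1 R | Squarefree n},
      ¬ (∏ p ∈ n.primeFactors, (if p ∣ h then 1 / (p : ℝ) else 0) = 0) →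
      n.primeFactors ⊆ h.primeFactors := by
    intro n _ hne p hp
    have hpp := Nat.prime_of_mem_primeFactors hp
    refine Nat.mem_primeFactors.mpr ⟨hpp, ?_, hh⟩
    by_contra hph
    exact hne (prod_eq_zero hp (if_neg hph))
  rw [← sum_filter_ne_zero]
  have hinj : Set.InjOn Nat.primeFactors
      (({x ∈ {n ∈ Icc 1 R | Squarefree n} |
        ∏ p ∈ x.primeFactors, (if p ∣ h then 1 / (p : ℝ) else 0) ≠ 0} : Finset ℕ) : Set ℕ) := by
    intro a ha b hb hab
    have ha' := (mem_filter.mp (mem_filter.mp (mem_coe.mp ha)).1).2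
    have hb' := (mem_filter.mp (mem_filter.mp (mem_coe.mp hb)).1).2
    rw [← Nat.prod_primeFactors_of_squarefree ha', ← Nat.prod_primeFactors_of_squarefree hb', hab]
  calc _ = ∑ t ∈ image Nat.primeFactors {x ∈ {n ∈ Icc 1 R | Squarefree n} |
        ∏ p ∈ x.primeFactors, (if p ∣ h then 1 / (p : ℝ) else 0) ≠ 0},
          ∏ p ∈ t, (if p ∣ h then 1 / (p : ℝ) else 0) := (sum_image hinj).symm
    _ ≤ ∑ t ∈ h.primeFactors.powerset, ∏ p ∈ t, (if p ∣ h then 1 / (p : ℝ) else 0) := by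
        refine sum_le_sum_of_subset_of_nonneg ?_ fun t _ _ => prod_nonneg fun p _ => by positivity
        intro t ht
        obtain ⟨n, hn, rfl⟩ := mem_image.mp ht
        exact mem_powerset.mpr (h1 n (mem_filter.mp hn).1 (mem_filter.mp hn).2)
    _ = _ := by
        refine sum_congr rfl fun t ht => prod_congr rfl fun p hp => if_pos ?_
        exact Nat.dvd_of_mem_primeFactors (mem_powerset.mp ht hp)

lemma prod_primeFactors_inv {n : ℕ} (hn : Squarefree n) :
    ∏ p ∈ n.primeFactors, (1 / (p : ℝ)) = 1 / n := by
  rw [prod_div_distrib, prod_const_one, ← Nat.cast_prod, Nat.prod_primeFactors_of_squarefree hn]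

lemma sum_Icc_inv_sq_le_two (R : ℕ) : ∑ b ∈ Icc 1 R, 1 / (b : ℝ) ^ 2 ≤ 2 := by
  have h := sum_Ioo_inv_sq_le (α := ℝ) 0 (R + 1)
  have he : Ioo 0 (R + 1) = Icc 1 R := by ext; simp; omega
  rw [he] at h
  simpa using h

lemma sum_inv_le_two_mul_squarefreeSum (R : ℕ) :
    ∑ n ∈ Icc 1 R, 1 / (n : ℝ) ≤ 2 * squarefreeSum (fun p => 1 / (p : ℝ)) R := by
  choose a b hab hsq using Nat.sq_mul_squarefree
  have hinj : Function.Injective (fun n => (b n, a n)) := by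
    intro x y hxy
    simp only [Prod.mk.injEq] at hxy
    rw [← hab x, ← hab y, hxy.1, hxy.2]
  calc ∑ n ∈ Icc 1 R, 1 / (n : ℝ)
      = ∑ n ∈ Icc 1 R, 1 / (b n : ℝ) ^ 2 * (1 / (a n : ℝ)) := by
        refine sum_congr rfl fun n _ => ?_
        conv_lhs => rw [← hab n]
        push_cast
        rw [one_div_mul_one_div]
    _ = ∑ x ∈ (Icc 1 R).image (fun n => (b n, a n)), 1 / (x.1 : ℝ) ^ 2 * (1 / (x.2 : ℝ)) := by
        rw [sum_image hinj.injOn]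
    _ ≤ ∑ x ∈ Icc 1 R ×ˢ {n ∈ Icc 1 R | Squarefree n}, 1 / (x.1 : ℝ) ^ 2 * (1 / (x.2 : ℝ)) := by
        refine sum_le_sum_of_subset_of_nonneg ?_ fun x _ _ => by positivity
        intro x hx
        obtain ⟨n, hn, rfl⟩ := mem_image.mp hx
        rw [mem_Icc] at hn
        have hn0 : b n ^ 2 * a n ≠ 0 := by rw [hab]; omega
        have ha0 : 0 < a n := Nat.pos_of_ne_zero (right_ne_zero_of_mul hn0)
        have hb0 : 0 < b n := Nat.pos_of_ne_zero fun h => by simp [h] at hn0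
        simp only [mem_product, mem_filter, mem_Icc]
        refine ⟨⟨hb0, ?_⟩, ⟨ha0, ?_⟩, hsq n⟩
        · calc b n ≤ b n ^ 2 := Nat.le_self_pow two_ne_zero _
            _ ≤ b n ^ 2 * a n := Nat.le_mul_of_pos_right _ ha0
            _ ≤ R := by rw [hab]; exact hn.2
        · calc a n ≤ b n ^ 2 * a n := Nat.le_mul_of_pos_left _ (by positivity)
            _ ≤ R := by rw [hab]; exact hn.2
    _ = (∑ b ∈ Icc 1 R, 1 / (b : ℝ) ^ 2) * squarefreeSum (fun p => 1 / (p : ℝ)) R := by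
        rw [sum_product, squarefreeSum, sum_mul_sum]
        refine sum_congr rfl fun x _ => sum_congr rfl fun n hn => ?_
        rw [prod_primeFactors_inv (mem_filter.mp hn).2]
    _ ≤ _ := by
        refine mul_le_mul_of_nonneg_right (sum_Icc_inv_sq_le_two R) ?_
        exact sum_nonneg fun n _ => prod_nonneg fun p _ => by positivity

lemma sq_squarefreeSum_le (R : ℕ) :
    squarefreeSum (fun p => 1 / (p : ℝ)) R ^ 2 ≤
      2 * squarefreeSum (fun p => 1 / (p : ℝ) + 1 / (p : ℝ)) (R ^ 2) := by
  set Q : Finset ℕ := {n ∈ Icc 1 R | Squarefree n} with hQ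
  let φ : ℕ × ℕ → ℕ × (ℕ × ℕ) := fun x =>
    (x.1.gcd x.2, (x.1 / x.1.gcd x.2, x.2 / x.1.gcd x.2))
  have hφ : ∀ x : ℕ × ℕ, (φ x).1 * (φ x).2.1 = x.1 ∧ (φ x).1 * (φ x).2.2 = x.2 := fun x =>
    ⟨Nat.mul_div_cancel' (Nat.gcd_dvd_left _ _), Nat.mul_div_cancel' (Nat.gcd_dvd_right _ _)⟩
  have hinj : Function.Injective φ := by
    intro x y hxy
    refine Prod.ext ?_ ?_
    · rw [← (hφ x).1, ← (hφ y).1, hxy]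
    · rw [← (hφ x).2, ← (hφ y).2, hxy]
  calc squarefreeSum (fun p => 1 / (p : ℝ)) R ^ 2
      = ∑ x ∈ Q ×ˢ Q, 1 / (x.1 : ℝ) * (1 / (x.2 : ℝ)) := by
        rw [squarefreeSum, sq, sum_mul_sum, ← sum_product']
        refine sum_congr rfl fun x hx => ?_
        rw [mem_product] at hx
        rw [prod_primeFactors_inv (mem_filter.mp hx.1).2,
          prod_primeFactors_inv (mem_filter.mp hx.2).2]
    _ = ∑ x ∈ Q ×ˢ Q, 1 / ((φ x).1 : ℝ) ^ 2 * (1 / ((φ x).2.1 : ℝ) * (1 / ((φ x).2.2 : ℝ))) := by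
        refine sum_congr rfl fun x _ => ?_
        conv_lhs => rw [← (hφ x).1, ← (hφ x).2]
        push_cast
        simp only [one_div, mul_inv]
        ring
    _ = ∑ y ∈ (Q ×ˢ Q).image φ, 1 / (y.1 : ℝ) ^ 2 * (1 / (y.2.1 : ℝ) * (1 / (y.2.2 : ℝ))) := by
        rw [sum_image hinj.injOn]
    _ ≤ ∑ y ∈ Icc 1 R ×ˢ squarefreePairs (R ^ 2),
          1 / (y.1 : ℝ) ^ 2 * (1 / (y.2.1 : ℝ) * (1 / (y.2.2 : ℝ))) := by
        refine sum_le_sum_of_subset_of_nonneg ?_ fun x _ _ => by positivity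
        intro y hy
        obtain ⟨x, hx, rfl⟩ := mem_image.mp hy
        simp only [hQ, mem_product, mem_filter, mem_Icc] at hx
        obtain ⟨⟨⟨h1, h2⟩, h3⟩, ⟨h4, h5⟩, h6⟩ := hx
        have hg : 0 < x.1.gcd x.2 := Nat.gcd_pos_of_pos_left _ h1
        rw [mem_product, mem_Icc, mem_squarefreePairs]
        refine ⟨⟨hg, (Nat.gcd_le_left _ h1).trans h2⟩, ?_, ?_⟩
        · rw [sq]
          exact Nat.mul_le_mul ((Nat.div_le_self _ _).trans h2) ((Nat.div_le_self _ _).trans h5)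
        · refine (Nat.squarefree_mul (Nat.coprime_div_gcd_div_gcd hg)).mpr ⟨?_, ?_⟩
          · exact h3.squarefree_of_dvd (Nat.div_dvd_of_dvd (Nat.gcd_dvd_left _ _))
          · exact h6.squarefree_of_dvd (Nat.div_dvd_of_dvd (Nat.gcd_dvd_right _ _))
    _ = (∑ b ∈ Icc 1 R, 1 / (b : ℝ) ^ 2) *
          squarefreeSum (fun p => 1 / (p : ℝ) + 1 / (p : ℝ)) (R ^ 2) := by
        rw [sum_product, squarefreeSum_add, sum_mul_sum]
        refine sum_congr rfl fun x _ => sum_congr rfl fun y hy => ?_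
        have h := (mem_squarefreePairs.mp hy).2
        rw [prod_primeFactors_inv h.of_mul_left, prod_primeFactors_inv h.of_mul_right]
    _ ≤ _ := by
        refine mul_le_mul_of_nonneg_right (sum_Icc_inv_sq_le_two R) ?_
        exact sum_nonneg fun n _ => prod_nonneg fun p _ => by positivity

lemma le_squarefreeSum_two_pow (m : ℕ) :
    (m : ℝ) / 4 ≤ squarefreeSum (fun p => 1 / (p : ℝ)) (2 ^ m) := by
  have h1 := log_add_one_le_harmonic (2 ^ m)
  rw [harmonic_eq_sum_Icc] at h1
  push_cast at h1
  have h2 : (m : ℝ) * Real.log 2 ≤ Real.log (2 ^ m + 1) := by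
    rw [← Real.log_pow]
    exact Real.log_le_log (by positivity) (by linarith)
  have h3 := sum_inv_le_two_mul_squarefreeSum (2 ^ m)
  simp only [one_div] at h3 ⊢
  have h4 : (m : ℝ) * (1 / 2) ≤ m * Real.log 2 := by
    gcongr
    linarith [Real.log_two_gt_d9]
  linarith

lemma le_squarefreeSum_four_pow (j : ℕ) :
    (j : ℝ) ^ 2 / 32 ≤ squarefreeSum (fun p => 1 / (p : ℝ) + 1 / (p : ℝ)) (4 ^ j) := by
  have h1 := le_squarefreeSum_two_pow j
  have h2 := sq_squarefreeSum_le (2 ^ j)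
  have h3 : ((2 : ℕ) ^ j) ^ 2 = 4 ^ j := by rw [← pow_mul, mul_comm, pow_mul]; norm_num
  rw [h3] at h2
  have h4 : ((j : ℝ) / 4) ^ 2 ≤ squarefreeSum (fun p => 1 / (p : ℝ)) (2 ^ j) ^ 2 := by gcongr
  nlinarith

end SquarefreeSums

section SieveBounds

open Finset

lemma rootCount_mul_add {M b p : ℕ} (hp : p.Prime) (hpM : ¬ p ∣ M) :
    rootCount (fun n => M * n + b) p = 1 := by
  have : Fact p.Prime := ⟨hp⟩
  have hM : (M : ZMod p) ≠ 0 := fun h => hpM ((ZMod.natCast_eq_zero_iff _ _).mp h)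
  rw [rootCount, card_eq_one]
  refine ⟨(-(b : ZMod p) / M).val, ?_⟩
  ext n
  simp only [mem_filter, mem_range, mem_singleton]
  have key : p ∣ M * n + b ↔ (n : ZMod p) = -(b : ZMod p) / M := by
    rw [← ZMod.natCast_eq_zero_iff, eq_div_iff hM]
    push_cast
    rw [mul_comm, eq_neg_iff_add_eq_zero]
  constructor
  · rintro ⟨h1, h2⟩
    rw [← key.mp h2, ZMod.val_natCast, Nat.mod_eq_of_lt h1]
  · rintro rfl
    exact ⟨ZMod.val_lt _, key.mpr (by rw [ZMod.natCast_zmod_val])⟩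

lemma rootCount_mul_add_self_of_dvd {h p : ℕ} (hp : p.Prime) (hph : p ∣ h) :
    rootCount (fun n => n * (n + h)) p = 1 := by
  rw [rootCount, card_eq_one]
  refine ⟨0, ?_⟩
  ext n
  simp only [mem_filter, mem_range, mem_singleton]
  constructor
  · rintro ⟨h1, h2⟩
    refine Nat.eq_zero_of_dvd_of_lt ?_ h1
    rcases hp.dvd_mul.mp h2 with h3 | h3
    · exact h3
    · exact (Nat.dvd_add_left hph).mp h3
  · rintro rfl
    exact ⟨hp.pos, by simp⟩

lemma rootCount_mul_add_self_of_not_dvd {h p : ℕ} (hp : p.Prime) (hph : ¬ p ∣ h) :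
    rootCount (fun n => n * (n + h)) p = 2 := by
  have hlt := Nat.mod_lt h hp.pos
  have hpos : 0 < h % p := Nat.pos_of_ne_zero fun h0 => hph (Nat.dvd_of_mod_eq_zero h0)
  have hroot : p ∣ p - h % p + h := by
    have h1 := Nat.mod_add_div h p
    exact ⟨1 + h / p, by rw [mul_add]; omega⟩
  rw [rootCount, card_eq_two]
  refine ⟨0, p - h % p, by omega, ?_⟩
  ext n
  simp only [mem_filter, mem_range, mem_insert, mem_singleton]
  constructor
  · rintro ⟨h1, h2⟩
    rcases hp.dvd_mul.mp h2 with h3 | h3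
    · exact Or.inl (Nat.eq_zero_of_dvd_of_lt h3 h1)
    · right
      have h4 : n + h ≡ p - h % p + h [MOD p] :=
        ((Nat.modEq_zero_iff_dvd.mpr h3).trans (Nat.modEq_zero_iff_dvd.mpr hroot).symm)
      exact Nat.ModEq.eq_of_lt_of_lt (Nat.ModEq.add_right_cancel' h h4) h1 (by omega)
  · rintro (rfl | rfl)
    · exact ⟨hp.pos, by simp⟩
    · exact ⟨by omega, hroot.mul_left _⟩

lemma card_primes_mod_eq_le {M : ℕ} (hM : 0 < M) (b : ℕ) {j : ℕ} (hj : 0 < j) :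
    (#{p ∈ range (M * 2 ^ (24 * j)) | p.Prime ∧ p % M = b} : ℝ) ≤
      2 * primeRatio M * 2 ^ (24 * j) / j + 3 * 2 ^ (12 * j) := by
  classical
  set R := 2 ^ (2 * j) with hR
  set N := 2 ^ (24 * j) with hN
  set f : ℕ → ℕ := fun n => M * n + b with hf
  set A : Finset ℕ := {n ∈ range N | ∀ q, q.Prime → q ≤ R → ¬ q ∣ f n} with hA
  have hR1 : 1 ≤ R := Nat.one_le_two_pow
  have hsub : {p ∈ range (M * N) | p.Prime ∧ p % M = b} ⊆ range (R + 1) ∪ A.image f := by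
    intro p hp
    simp only [mem_filter, mem_range] at hp
    obtain ⟨h1, h2, h3⟩ := hp
    rw [mem_union, mem_range, mem_image]
    by_cases hpR : p ≤ R
    · left; omega
    · right
      have hfp : f (p / M) = p := by
        have := Nat.div_add_mod p M
        simp only [hf]; omega
      refine ⟨p / M, mem_filter.mpr ⟨mem_range.mpr (Nat.div_lt_of_lt_mul h1), ?_⟩, hfp⟩
      rw [hfp]
      intro q hq hqR hqp
      rw [(Nat.prime_dvd_prime_iff_eq hq h2).mp hqp] at hqR
      exact hpR hqR
  set k : ℕ → ℝ := fun p => if p ∣ M then 0 else 1 / (p : ℝ) with hk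
  have hk0 : ∀ p, 0 ≤ k p := fun p => by simp only [hk]; positivity
  have hsieve := card_sifted_le (f := f) (k := k) (R := R) (N := N) (A := A)
    (fun d x y hxy => (hxy.mul_left M).add_right b)
    (fun x y hxy => Nat.eq_of_mul_eq_mul_left hM (Nat.add_right_cancel hxy)) hk0 hR1
    (fun p hp _ hkp => by
      have hpM : ¬ p ∣ M := fun h => hkp (if_pos h)
      have h1 : rootCount f p = 1 := rootCount_mul_add hp hpM
      rw [h1]
      refine ⟨?_, hp.one_lt⟩
      simp [hk, hpM])
    (filter_subset _ _) (fun n hn => (mem_filter.mp hn).2)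
  have hS : (j : ℝ) / 2 ≤ squarefreeSum k R * primeRatio M := by
    have h1 := le_squarefreeSum_two_pow (2 * j)
    have h2 := squarefreeSum_add_le (l := fun p => if p ∣ M then 1 / (p : ℝ) else 0) hk0
      (fun p => by positivity) R
    have h3 := squarefreeSum_le_primeRatio hM.ne' R
    have h4 : (fun p => k p + if p ∣ M then 1 / (p : ℝ) else 0) = fun p : ℕ => 1 / (p : ℝ) := by
      funext p
      by_cases h : p ∣ M <;> simp [hk, h]
    rw [h4] at h2
    have h5 := one_le_squarefreeSum hk0 hR1
    have h6 : squarefreeSum k R * squarefreeSum (fun p => if p ∣ M then 1 / (p : ℝ) else 0) R ≤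
      squarefreeSum k R * primeRatio M := by gcongr
    push_cast at h1
    linarith
  have hS1 : 0 < squarefreeSum k R := zero_lt_one.trans_le (one_le_squarefreeSum hk0 hR1)
  have hjR : (0 : ℝ) < j := by exact_mod_cast hj
  have hdiv : (N : ℝ) / squarefreeSum k R ≤ 2 * primeRatio M * N / j := by
    rw [div_le_div_iff₀ hS1 hjR]
    have : (0 : ℝ) ≤ N := by positivity
    nlinarith
  have hcard : (#{p ∈ range (M * N) | p.Prime ∧ p % M = b} : ℝ) ≤ (R + 1) + #A := by
    have h1 := (card_le_card hsub).trans (card_union_le _ _)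
    rw [card_range] at h1
    have h2 : #(A.image f) ≤ #A := card_image_le
    exact_mod_cast h1.trans (by omega)
  have hR6 : (R : ℝ) ^ 6 = 2 ^ (12 * j) := by
    rw [hR]; push_cast; rw [← pow_mul]; congr 1; ring
  have hR1' : (1 : ℝ) ≤ R := by exact_mod_cast hR1
  have hRR : (R : ℝ) ≤ R ^ 6 := le_self_pow₀ hR1' (by norm_num)
  rw [hR6] at hsieve hRR
  have hNr : (N : ℝ) = 2 ^ (24 * j) := by rw [hN]; push_cast; rfl
  rw [hNr] at hdiv hsieve
  linarith

lemma card_prime_pairs_le {h : ℕ} (hh : 0 < h) (heven : Even h) {j : ℕ} (hj : 0 < j) :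
    (#{p ∈ range (2 ^ (24 * j)) | p.Prime ∧ (p + h).Prime} : ℝ) ≤
      32 * primeRatio h * 2 ^ (24 * j) / j ^ 2 + 3 * 2 ^ (12 * j) := by
  classical
  set R := 4 ^ j with hR
  set N := 2 ^ (24 * j) with hN
  set f : ℕ → ℕ := fun n => n * (n + h) with hf
  set A : Finset ℕ := {n ∈ range N | ∀ q, q.Prime → q ≤ R → ¬ q ∣ f n} with hA
  have hR1 : 1 ≤ R := Nat.one_le_pow _ _ (by norm_num)
  have hsub : {p ∈ range N | p.Prime ∧ (p + h).Prime} ⊆ range (R + 1) ∪ A := by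
    intro p hp
    simp only [mem_filter, mem_range] at hp
    obtain ⟨h1, h2, h3⟩ := hp
    rw [mem_union, mem_range]
    by_cases hpR : p ≤ R
    · left; omega
    · right
      refine mem_filter.mpr ⟨mem_range.mpr h1, fun q hq hqR hqp => ?_⟩
      rcases hq.dvd_mul.mp hqp with h4 | h4
      · rw [(Nat.prime_dvd_prime_iff_eq hq h2).mp h4] at hqR
        exact hpR hqR
      · rw [(Nat.prime_dvd_prime_iff_eq hq h3).mp h4] at hqR
        omega
  set k : ℕ → ℝ := fun p => if p ∣ h then 1 / (p : ℝ) else 1 / (p : ℝ) + 1 / (p : ℝ) with hk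
  have hk0 : ∀ p, 0 ≤ k p := fun p => by simp only [hk]; positivity
  have hmono : StrictMono f := fun x y hxy =>
    Nat.mul_lt_mul'' hxy (Nat.add_lt_add_right hxy h)
  have hsieve := card_sifted_le (f := f) (k := k) (R := R) (N := N) (A := A)
    (fun d x y hxy => hxy.mul (hxy.add_right h)) hmono.injective hk0 hR1
    (fun p hp _ _ => by
      by_cases hph : p ∣ h
      · have h1 : rootCount f p = 1 := rootCount_mul_add_self_of_dvd hp hph
        rw [h1]
        refine ⟨?_, hp.one_lt⟩
        simp [hk, hph]
      · have h1 : rootCount f p = 2 := rootCount_mul_add_self_of_not_dvd hp hph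
        rw [h1]
        refine ⟨?_, hp.two_le.lt_of_ne fun h2 => hph (h2 ▸ heven.two_dvd)⟩
        simp only [hk, hph, if_false]
        push_cast
        rw [← add_div]
        norm_num)
    (filter_subset _ _) (fun n hn => (mem_filter.mp hn).2)
  have hS : (j : ℝ) ^ 2 / 32 ≤ squarefreeSum k R * primeRatio h := by
    have h1 := le_squarefreeSum_four_pow j
    have h2 := squarefreeSum_add_le (l := fun p => if p ∣ h then 1 / (p : ℝ) else 0) hk0
      (fun p => by positivity) R
    have h3 := squarefreeSum_le_primeRatio hh.ne' R
    have h4 : (fun p => k p + if p ∣ h then 1 / (p : ℝ) else 0) =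
        fun p : ℕ => 1 / (p : ℝ) + 1 / (p : ℝ) := by
      funext p
      by_cases h : p ∣ h <;> simp [hk, h]
    rw [h4] at h2
    have h5 := one_le_squarefreeSum hk0 hR1
    have h6 : squarefreeSum k R * squarefreeSum (fun p => if p ∣ h then 1 / (p : ℝ) else 0) R ≤
      squarefreeSum k R * primeRatio h := by gcongr
    linarith
  have hS1 : 0 < squarefreeSum k R := zero_lt_one.trans_le (one_le_squarefreeSum hk0 hR1)
  have hjR : (0 : ℝ) < j ^ 2 := by positivity
  have hdiv : (N : ℝ) / squarefreeSum k R ≤ 32 * primeRatio h * N / j ^ 2 := by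
    rw [div_le_div_iff₀ hS1 hjR]
    have : (0 : ℝ) ≤ N := by positivity
    nlinarith
  have hcard : (#{p ∈ range N | p.Prime ∧ (p + h).Prime} : ℝ) ≤ (R + 1) + #A := by
    have h1 := (card_le_card hsub).trans (card_union_le _ _)
    rw [card_range] at h1
    exact_mod_cast h1
  have hR6 : (R : ℝ) ^ 6 = 2 ^ (12 * j) := by
    have h4 : (4 : ℝ) = 2 ^ 2 := by norm_num
    rw [hR]; push_cast; rw [h4, ← pow_mul, ← pow_mul]; congr 1; ring
  have hR1' : (1 : ℝ) ≤ R := by exact_mod_cast hR1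
  have hRR : (R : ℝ) ≤ R ^ 6 := le_self_pow₀ hR1' (by norm_num)
  rw [hR6] at hsieve hRR
  have hNr : (N : ℝ) = 2 ^ (24 * j) := by rw [hN]; push_cast; rfl
  rw [hNr] at hdiv hsieve
  linarith

end SieveBounds

section PrimeRatioBounds

open Finset

lemma prod_one_add_inv_le_exp {s : Finset ℕ} {x : ℝ} (hx : 0 < x) (hs : ∀ p ∈ s, x ≤ p) :
    ∏ p ∈ s, (1 + 1 / (p : ℝ)) ≤ Real.exp (#s / x) := by
  calc ∏ p ∈ s, (1 + 1 / (p : ℝ)) ≤ ∏ _p ∈ s, Real.exp (1 / x) := by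
        refine prod_le_prod (fun p _ => by positivity) fun p hp => ?_
        have h1 : 1 / (p : ℝ) ≤ 1 / x := one_div_le_one_div_of_le hx (hs p hp)
        linarith [Real.add_one_le_exp (1 / x)]
    _ = _ := by
        rw [prod_const, ← Real.exp_nat_mul]
        congr 1
        ring

lemma card_le_of_prod_le {s : Finset ℕ} {m k : ℕ} (hs : ∀ p ∈ s, 2 ^ m ≤ p)
    (hprod : ∏ p ∈ s, p ≤ 2 ^ k) : m * #s ≤ k := by
  have h := (pow_card_le_prod s (fun p => p) (2 ^ m) hs).trans hprod
  rw [← pow_mul] at h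
  exact (Nat.pow_le_pow_iff_right (by norm_num)).mp h

lemma primeRatio_primorial_succ_le {m : ℕ} (hm : 16 ≤ m) :
    primeRatio (primorial (2 ^ (m + 1))) ≤ 4 / 3 * primeRatio (primorial (2 ^ m)) := by
  set B : Finset ℕ := {p ∈ range (2 ^ (m + 1) + 1) | p.Prime ∧ 2 ^ m < p} with hB
  have hsplit : (primorial (2 ^ (m + 1))).primeFactors ⊆ (primorial (2 ^ m)).primeFactors ∪ B := by
    intro p hp
    have hpp := Nat.prime_of_mem_primeFactors hp
    have hle := hpp.dvd_primorial_iff.mp (Nat.dvd_of_mem_primeFactors hp)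
    rw [mem_union, Nat.mem_primeFactors, hpp.dvd_primorial_iff, hB, mem_filter, mem_range]
    by_cases h : p ≤ 2 ^ m
    · exact Or.inl ⟨hpp, h, primorial_ne_zero _⟩
    · exact Or.inr ⟨by omega, hpp, by omega⟩
  have hdisj : Disjoint (primorial (2 ^ m)).primeFactors B := by
    refine Finset.disjoint_left.mpr fun p hp hp' => ?_
    have hpp := Nat.prime_of_mem_primeFactors hp
    have hle := hpp.dvd_primorial_iff.mp (Nat.dvd_of_mem_primeFactors hp)
    have := (mem_filter.mp hp').2.2
    omega
  have hBprod : ∏ p ∈ B, p ≤ 2 ^ 2 ^ (m + 2) := by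
    calc ∏ p ∈ B, p ≤ primorial (2 ^ (m + 1)) := by
          refine prod_le_prod_of_subset_of_one_le' ?_ fun p hp _ => (mem_filter.mp hp).2.one_le
          intro p hp
          rw [hB, mem_filter] at hp
          exact mem_filter.mpr ⟨hp.1, hp.2.1⟩
      _ ≤ 4 ^ 2 ^ (m + 1) := primorial_le_four_pow _
      _ = 2 ^ 2 ^ (m + 2) := by
          rw [show 4 = 2 ^ 2 by norm_num, ← pow_mul]
          congr 1
          ring
  have hcard := card_le_of_prod_le (fun p hp => (mem_filter.mp hp).2.2.le) hBprod
  have hcard' : (#B : ℝ) / 2 ^ m ≤ 1 / 4 := by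
    rw [div_le_iff₀ (by positivity)]
    have h1 : 16 * #B ≤ 2 ^ (m + 2) := (Nat.mul_le_mul_right _ hm).trans hcard
    have h2 : (16 : ℝ) * #B ≤ 2 ^ (m + 2) := by exact_mod_cast h1
    rw [pow_add] at h2
    linarith
  have hexp : Real.exp (1 / 4) ≤ 4 / 3 := by
    have h1 := Real.add_one_le_exp (-(1 / 4 : ℝ))
    rw [Real.exp_neg] at h1
    have h2 := Real.exp_pos (1 / 4)
    have h3 := mul_inv_cancel₀ h2.ne'
    nlinarith
  have hprodB : ∏ p ∈ B, (1 + 1 / (p : ℝ)) ≤ 4 / 3 :=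
    (prod_one_add_inv_le_exp (x := 2 ^ m) (by positivity) fun p hp => by
      exact_mod_cast (mem_filter.mp hp).2.2.le).trans
      ((Real.exp_le_exp.mpr hcard').trans hexp)
  calc primeRatio (primorial (2 ^ (m + 1)))
      ≤ ∏ p ∈ (primorial (2 ^ m)).primeFactors ∪ B, (1 + 1 / (p : ℝ)) := by
        refine prod_le_prod_of_subset_of_one_le hsplit (fun p _ => by positivity) fun p _ _ => ?_
        have : (0 : ℝ) ≤ 1 / p := by positivity
        linarith
    _ = primeRatio (primorial (2 ^ m)) * ∏ p ∈ B, (1 + 1 / (p : ℝ)) := prod_union hdisj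
    _ ≤ primeRatio (primorial (2 ^ m)) * (4 / 3) := by
        gcongr
        exact zero_le_one.trans (one_le_primeRatio _)
    _ = _ := mul_comm _ _

lemma exists_primeRatio_primorial_le :
    ∃ C : ℝ, 0 < C ∧ ∀ m, primeRatio (primorial (2 ^ m)) ≤ C * (4 / 3) ^ m := by
  have hmono : ∀ m, primeRatio (primorial (2 ^ m)) ≤ primeRatio (primorial (2 ^ (m + 16))) :=
    fun m => by
      refine prod_le_prod_of_subset_of_one_le
        (Nat.primeFactors_mono (primorial_dvd_primorial (Nat.pow_le_pow_right two_pos (by omega)))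
          (primorial_ne_zero _)) (fun p _ => by positivity) fun p _ _ => ?_
      have : (0 : ℝ) ≤ 1 / p := by positivity
      linarith
  refine ⟨primeRatio (primorial (2 ^ 16)), zero_lt_one.trans_le (one_le_primeRatio _),
    fun m => (hmono m).trans ?_⟩
  induction m with
  | zero => simp
  | succ m ih =>
    rw [show m + 1 + 16 = m + 16 + 1 by ring, pow_succ (4 / 3 : ℝ)]
    linarith [primeRatio_primorial_succ_le (m := m + 16) (by omega)]

lemma exists_primeRatio_le :
    ∃ C : ℝ, 0 < C ∧ ∀ m n, n ≠ 0 → n ≤ 2 ^ 2 ^ m → primeRatio n ≤ C * (4 / 3) ^ m := by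
  obtain ⟨C, hC, h⟩ := exists_primeRatio_primorial_le
  refine ⟨C * Real.exp 1, by positivity, fun m n hn hnm => ?_⟩
  set B : Finset ℕ := {p ∈ n.primeFactors | ¬ p ≤ 2 ^ m} with hB
  have hBprod : ∏ p ∈ B, p ≤ 2 ^ 2 ^ m := by
    calc ∏ p ∈ B, p ≤ ∏ p ∈ n.primeFactors, p :=
          prod_le_prod_of_subset_of_one_le' (filter_subset _ _) fun p hp _ =>
            (Nat.prime_of_mem_primeFactors hp).one_le
      _ ≤ n := Nat.le_of_dvd (Nat.pos_of_ne_zero hn) (Nat.prod_primeFactors_dvd n)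
      _ ≤ _ := hnm
  have hcard : 1 * #B ≤ 2 ^ m := card_le_of_prod_le (fun p hp => by
    simpa using (Nat.prime_of_mem_primeFactors (mem_filter.mp hp).1).two_le) hBprod
  have hcard' : (#B : ℝ) / 2 ^ m ≤ 1 := by
    rw [div_le_one (by positivity)]
    exact_mod_cast (one_mul #B ▸ hcard)
  have hprodB : ∏ p ∈ B, (1 + 1 / (p : ℝ)) ≤ Real.exp 1 :=
    (prod_one_add_inv_le_exp (x := 2 ^ m) (by positivity) fun p hp => by
      exact_mod_cast (not_le.mp (mem_filter.mp hp).2).le).trans (Real.exp_le_exp.mpr hcard')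
  have hsmall : ∏ p ∈ n.primeFactors with p ≤ 2 ^ m, (1 + 1 / (p : ℝ)) ≤
      primeRatio (primorial (2 ^ m)) := by
    refine prod_le_prod_of_subset_of_one_le ?_ (fun p _ => by positivity) fun p _ _ => ?_
    · intro p hp
      rw [mem_filter] at hp
      have hpp := Nat.prime_of_mem_primeFactors hp.1
      exact Nat.mem_primeFactors.mpr ⟨hpp, hpp.dvd_primorial_iff.mpr hp.2, primorial_ne_zero _⟩
    · have : (0 : ℝ) ≤ 1 / p := by positivity
      linarith
  calc primeRatio n = (∏ p ∈ n.primeFactors with p ≤ 2 ^ m, (1 + 1 / (p : ℝ))) *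
        ∏ p ∈ B, (1 + 1 / (p : ℝ)) := (prod_filter_mul_prod_filter_not _ _ _).symm
    _ ≤ C * (4 / 3) ^ m * Real.exp 1 :=
        mul_le_mul (hsmall.trans (h m)) hprodB (prod_nonneg fun p _ => by positivity)
          (by positivity)
    _ = _ := by ring

lemma primeRatio_eq_sum {n : ℕ} (hn : n ≠ 0) :
    primeRatio n = ∑ d ∈ n.divisors with Squarefree d, 1 / (d : ℝ) := by
  rw [Nat.sum_divisors_filter_squarefree hn, primeRatio, prod_one_add, Nat.factors_eq]
  refine sum_congr rfl fun t _ => ?_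
  rw [prod_div_distrib, prod_const_one, ← Nat.cast_prod, prod_val]
  rfl

lemma primeRatio_mul_le (a b : ℕ) : primeRatio (a * b) ≤ primeRatio a * primeRatio b := by
  rcases eq_or_ne a 0 with rfl | ha
  · simpa [primeRatio] using one_le_primeRatio b
  rcases eq_or_ne b 0 with rfl | hb
  · simpa [primeRatio] using one_le_primeRatio a
  rw [primeRatio, Nat.primeFactors_mul ha hb, primeRatio, primeRatio, ← prod_union_inter]
  refine le_mul_of_one_le_right (prod_nonneg fun p _ => by positivity) ?_
  calc (1 : ℝ) = ∏ _p ∈ a.primeFactors ∩ b.primeFactors, 1 := by simp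
    _ ≤ _ := prod_le_prod (fun _ _ => zero_le_one) fun p _ => by
        have : (0 : ℝ) ≤ 1 / p := by positivity
        linarith

lemma dvd_two_pow_sub_one_iff (d n : ℕ) : d ∣ 2 ^ n - 1 ↔ orderOf (2 : ZMod d) ∣ n := by
  rw [orderOf_dvd_iff_pow_eq_one, ← ZMod.natCast_eq_zero_iff, Nat.cast_sub Nat.one_le_two_pow]
  push_cast
  exact sub_eq_zero

lemma two_pow_sub_one_ne_zero {n : ℕ} (hn : n ≠ 0) : 2 ^ n - 1 ≠ 0 := by
  have := Nat.one_lt_two_pow hn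
  omega

/-- The product of the numbers `2 ^ m - 1` with `1 ≤ m ≤ n`. -/
def mersenneProd (n : ℕ) : ℕ := ∏ m ∈ Icc 1 n, (2 ^ m - 1)

lemma mersenneProd_ne_zero (n : ℕ) : mersenneProd n ≠ 0 :=
  prod_ne_zero_iff.mpr fun m hm => two_pow_sub_one_ne_zero (by rw [mem_Icc] at hm; omega)

lemma mersenneProd_le (n : ℕ) : mersenneProd n ≤ 2 ^ (n ^ 2) := by
  calc mersenneProd n ≤ ∏ _m ∈ Icc 1 n, 2 ^ n := prod_le_prod' fun m hm =>
        (Nat.sub_le _ _).trans (Nat.pow_le_pow_right two_pos (mem_Icc.mp hm).2)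
    _ = _ := by rw [prod_const, Nat.card_Icc, ← pow_mul, sq, Nat.add_sub_cancel]

lemma exists_sum_primeRatio_le :
    ∃ C : ℝ, 0 < C ∧ ∀ K : ℕ, ∑ n ∈ Icc 1 K, primeRatio (2 ^ n - 1) ≤ C * K := by
  obtain ⟨C, hC, h⟩ := exists_primeRatio_le
  refine ⟨16 * C, by positivity, fun K => ?_⟩
  set T : Finset ℕ := {d ∈ (mersenneProd K).divisors | Squarefree d ∧
    ∃ n ∈ Icc 1 K, d ∣ 2 ^ n - 1} with hT
  set o : ℕ → ℕ := fun d => orderOf (2 : ZMod d) with ho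
  have hTo : ∀ d ∈ T, 0 < o d ∧ o d ≤ K ∧ Squarefree d := by
    intro d hd
    obtain ⟨_, hsq, n, hn, hdn⟩ := mem_filter.mp hd
    rw [mem_Icc] at hn
    have h1 := (dvd_two_pow_sub_one_iff d n).mp hdn
    exact ⟨Nat.pos_of_dvd_of_pos h1 hn.1, (Nat.le_of_dvd hn.1 h1).trans hn.2, hsq⟩
  have hfib : ∀ i ∈ range (K + 1), ∑ d ∈ T with Nat.log 2 (o d) = i, 1 / (d : ℝ) * (1 / o d) ≤
      C * (16 / 9) * (8 / 9) ^ i := by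
    intro i _
    have h1 : ∀ d ∈ {d ∈ T | Nat.log 2 (o d) = i},
        1 / (d : ℝ) * (1 / o d) ≤ (1 / 2) ^ i * (1 / (d : ℝ)) := by
      intro d hd
      obtain ⟨hdT, rfl⟩ := mem_filter.mp hd
      have h2 : 2 ^ Nat.log 2 (o d) ≤ o d := Nat.pow_log_le_self 2 (hTo d hdT).1.ne'
      have h3 : (2 : ℝ) ^ Nat.log 2 (o d) ≤ o d := by exact_mod_cast h2
      rw [mul_comm, one_div_pow]
      gcongr
    have hsub : {d ∈ T | Nat.log 2 (o d) = i} ⊆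
        {d ∈ (mersenneProd (2 ^ (i + 1))).divisors | Squarefree d} := by
      intro d hd
      obtain ⟨hdT, rfl⟩ := mem_filter.mp hd
      obtain ⟨h2, -, h3⟩ := hTo d hdT
      rw [mem_filter, Nat.mem_divisors]
      refine ⟨⟨?_, mersenneProd_ne_zero _⟩, h3⟩
      have h4 : d ∣ 2 ^ o d - 1 := (dvd_two_pow_sub_one_iff d (o d)).mpr dvd_rfl
      refine h4.trans (dvd_prod_of_mem (fun m => 2 ^ m - 1) ?_)
      exact mem_Icc.mpr ⟨h2, (Nat.lt_pow_succ_log_self one_lt_two _).le⟩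
    calc ∑ d ∈ T with Nat.log 2 (o d) = i, 1 / (d : ℝ) * (1 / o d)
        ≤ ∑ d ∈ T with Nat.log 2 (o d) = i, (1 / 2) ^ i * (1 / (d : ℝ)) := sum_le_sum h1
      _ = (1 / 2) ^ i * ∑ d ∈ T with Nat.log 2 (o d) = i, 1 / (d : ℝ) := by rw [mul_sum]
      _ ≤ (1 / 2) ^ i * primeRatio (mersenneProd (2 ^ (i + 1))) := by
          rw [primeRatio_eq_sum (mersenneProd_ne_zero _)]
          gcongr
      _ ≤ (1 / 2) ^ i * (C * (4 / 3) ^ (2 * (i + 1))) := by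
          gcongr
          refine h _ _ (mersenneProd_ne_zero _) ((mersenneProd_le _).trans_eq ?_)
          rw [← pow_mul, mul_comm 2]
      _ = _ := by
          rw [pow_mul, pow_succ, show (8 / 9 : ℝ) = 1 / 2 * (4 / 3) ^ 2 by norm_num, mul_pow]
          ring
  have hsum : ∑ d ∈ T, 1 / (d : ℝ) * (1 / o d) ≤ 16 * C := by
    rw [← sum_fiberwise_of_maps_to (t := range (K + 1)) (g := fun d => Nat.log 2 (o d))]
    · calc _ ≤ ∑ i ∈ range (K + 1), C * (16 / 9) * (8 / 9 : ℝ) ^ i := sum_le_sum hfib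
        _ = C * (16 / 9) * ∑ i ∈ range (K + 1), (8 / 9 : ℝ) ^ i := by rw [mul_sum]
        _ ≤ C * (16 / 9) * (1 - 8 / 9)⁻¹ := by
            gcongr
            exact ((summable_geometric_of_lt_one (by norm_num) (by norm_num)).sum_le_tsum _
              fun _ _ => by positivity).trans_eq
              (tsum_geometric_of_lt_one (by norm_num) (by norm_num))
        _ = _ := by ring
    · intro d hd
      rw [mem_range]
      have := Nat.log_le_self 2 (o d)
      have := (hTo d hd).2.1
      omega
  have hcount : ∀ d ∈ T, ∑ n ∈ Icc 1 K, (if d ∣ 2 ^ n - 1 then (1 : ℝ) else 0) ≤ K * (1 / o d) := by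
    intro d hd
    rw [sum_boole]
    have h1 : {n ∈ Icc 1 K | d ∣ 2 ^ n - 1} = {n ∈ Ioc 0 K | o d ∣ n} := by
      ext n
      simp only [mem_filter, mem_Icc, mem_Ioc, dvd_two_pow_sub_one_iff]
      rfl
    rw [h1, Nat.Ioc_filter_dvd_card_eq_div, mul_one_div]
    exact Nat.cast_div_le
  calc ∑ n ∈ Icc 1 K, primeRatio (2 ^ n - 1)
      = ∑ n ∈ Icc 1 K, ∑ d ∈ T, 1 / (d : ℝ) * (if d ∣ 2 ^ n - 1 then (1 : ℝ) else 0) := by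
        refine sum_congr rfl fun n hn => ?_
        have hn0 : 2 ^ n - 1 ≠ 0 := two_pow_sub_one_ne_zero (by rw [mem_Icc] at hn; omega)
        rw [primeRatio_eq_sum hn0]
        simp only [mul_ite, mul_one, mul_zero]
        rw [← sum_filter]
        refine sum_congr ?_ fun _ _ => rfl
        ext d
        simp only [hT, mem_filter, Nat.mem_divisors]
        constructor
        · rintro ⟨⟨h1, -⟩, h2⟩
          exact ⟨⟨⟨h1.trans (dvd_prod_of_mem (fun m => 2 ^ m - 1) hn), mersenneProd_ne_zero _⟩,
            h2, n, hn, h1⟩, h1⟩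
        · rintro ⟨⟨-, h1, -⟩, h2⟩
          exact ⟨⟨h2, hn0⟩, h1⟩
    _ = ∑ d ∈ T, 1 / (d : ℝ) * ∑ n ∈ Icc 1 K, (if d ∣ 2 ^ n - 1 then (1 : ℝ) else 0) := by
        rw [sum_comm]
        exact sum_congr rfl fun d _ => by rw [mul_sum]
    _ ≤ ∑ d ∈ T, 1 / (d : ℝ) * (K * (1 / o d)) :=
        sum_le_sum fun d hd => mul_le_mul_of_nonneg_left (hcount d hd) (by positivity)
    _ = (∑ d ∈ T, 1 / (d : ℝ) * (1 / o d)) * K := by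
        rw [sum_mul]
        exact sum_congr rfl fun d _ => by ring
    _ ≤ _ := by gcongr

end PrimeRatioBounds

section Romanoff

open Finset

lemma card_sq_le_card_image_mul {α β : Type*} [DecidableEq β] (s : Finset α) (f : α → β) :
    #s ^ 2 ≤ #(s.image f) * ∑ x ∈ s, #{y ∈ s | f y = f x} := by
  have h1 : #s = ∑ b ∈ s.image f, #{y ∈ s | f y = b} := card_eq_sum_card_image f s
  have h2 : ∑ x ∈ s, #{y ∈ s | f y = f x} = ∑ b ∈ s.image f, #{y ∈ s | f y = b} ^ 2 := by
    rw [← sum_fiberwise_of_maps_to (t := s.image f) (g := f) fun x hx => mem_image_of_mem f hx]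
    refine sum_congr rfl fun b _ => ?_
    rw [sum_congr rfl (g := fun _ => #{y ∈ s | f y = b})
      fun x hx => by rw [(mem_filter.mp hx).2], sum_const, smul_eq_mul, sq]
  rw [h2]
  conv_lhs => rw [h1]
  exact sq_sum_le_card_mul_sum_sq

/-- The odd primes below `N`. -/
def oddPrimesBelow (N : ℕ) : Finset ℕ := {p ∈ range N | p.Prime ∧ p ≠ 2}

lemma mem_oddPrimesBelow {N p : ℕ} : p ∈ oddPrimesBelow N ↔ p < N ∧ p.Prime ∧ p ≠ 2 := by
  rw [oddPrimesBelow, mem_filter, mem_range]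

lemma four_mul_add_two_le_two_pow {K : ℕ} (hK : 5 ≤ K) : 4 * K + 2 ≤ 2 ^ K := by
  induction K, hK using Nat.le_induction with
  | base => norm_num
  | succ n hn ih =>
    rw [pow_succ]
    omega

lemma two_pow_half_le_card_oddPrimesBelow {K : ℕ} (hK : 5 ≤ K) :
    (2 : ℝ) ^ K / 2 ≤ K * #(oddPrimesBelow (2 ^ K)) := by
  have hcard : Nat.primeCounting (2 ^ K) ≤ #(oddPrimesBelow (2 ^ K)) + 1 := by
    rw [Nat.primeCounting, ← Nat.primesBelow_card_eq_primeCounting']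
    refine (card_le_card (t := insert 2 (oddPrimesBelow (2 ^ K))) ?_).trans (card_insert_le _ _)
    intro p hp
    obtain ⟨h1, h2⟩ := Nat.mem_primesBelow.mp hp
    rw [mem_insert, mem_oddPrimesBelow]
    by_cases h : p = 2
    · exact Or.inl h
    · refine Or.inr ⟨(Nat.lt_succ_iff.mp h1).lt_of_ne fun h3 => h ?_, h2, h⟩
      have h4 : 2 ∣ p := h3 ▸ dvd_pow_self 2 (by omega)
      exact ((Nat.prime_dvd_prime_iff_eq Nat.prime_two h2).mp h4).symm
  have hpi := Chebyshev.pi_ge (2 ^ K)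
  push_cast at hpi
  have hlog2 : 0 < Real.log 2 := Real.log_pos one_lt_two
  have hK0 : (0 : ℝ) < K := by exact_mod_cast (by omega : 0 < K)
  rw [Real.log_pow, div_le_iff₀ (by positivity)] at hpi
  have hlog : Real.log (2 ^ K + 1) ≤ (K + 1) * Real.log 2 := by
    have h1 : ((K : ℝ) + 1) * Real.log 2 = Real.log (2 ^ (K + 1)) := by
      rw [Real.log_pow]; push_cast; rfl
    rw [h1]
    refine Real.log_le_log (by positivity) ?_
    have : (1 : ℝ) ≤ 2 ^ K := one_le_pow₀ one_le_two
    rw [pow_succ]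
    linarith
  have h1 : (2 : ℝ) ^ K - (K + 1) ≤ Nat.primeCounting (2 ^ K) * K := by
    refine le_of_mul_le_mul_right ?_ hlog2
    linarith
  have h2 : (Nat.primeCounting (2 ^ K) : ℝ) ≤ #(oddPrimesBelow (2 ^ K)) + 1 := by
    exact_mod_cast hcard
  have h3 : (Nat.primeCounting (2 ^ K) : ℝ) * K ≤ (#(oddPrimesBelow (2 ^ K)) + 1) * K := by gcongr
  have h4 : (4 * K + 2 : ℝ) ≤ 2 ^ K := by
    exact_mod_cast four_mul_add_two_le_two_pow hK
  linarith

lemma card_oddPrimesBelow_le {j : ℕ} (hj : 0 < j) :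
    (#(oddPrimesBelow (2 ^ (24 * j))) : ℝ) ≤ 2 * 2 ^ (24 * j) / j + 3 * 2 ^ (12 * j) := by
  have h := card_primes_mod_eq_le one_pos 0 hj
  rw [one_mul, show primeRatio 1 = 1 by simp [primeRatio], mul_one] at h
  refine le_trans ?_ h
  norm_cast
  refine card_le_card fun p hp => ?_
  rw [mem_oddPrimesBelow] at hp
  exact mem_filter.mpr ⟨mem_range.mpr hp.1, hp.2.1, Nat.mod_one p⟩

lemma primeRatio_two_pow_le (l : ℕ) : primeRatio (2 ^ l) ≤ 3 / 2 := by
  rcases eq_or_ne l 0 with rfl | hl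
  · norm_num [primeRatio]
  · rw [primeRatio, Nat.primeFactors_prime_pow hl Nat.prime_two]
    norm_num

lemma card_collisions_lt {j k l : ℕ} (hj : 0 < j) (hl : 0 < l) (hlk : l < k) :
    (#{x ∈ oddPrimesBelow (2 ^ (24 * j)) ×ˢ oddPrimesBelow (2 ^ (24 * j)) |
      x.1 + 2 ^ k = x.2 + 2 ^ l} : ℝ) ≤
      48 * primeRatio (2 ^ (k - l) - 1) * 2 ^ (24 * j) / j ^ 2 + 3 * 2 ^ (12 * j) := by
  have hpow : 2 ^ l < 2 ^ k := Nat.pow_lt_pow_right one_lt_two hlk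
  have hfac : 2 ^ l * (2 ^ (k - l) - 1) = 2 ^ k - 2 ^ l := by
    rw [Nat.mul_sub, ← pow_add, Nat.add_sub_cancel' hlk.le, mul_one]
  have heven : Even (2 ^ k - 2 ^ l) := by
    rw [← hfac]
    exact ((even_two).pow_of_ne_zero hl.ne').mul_right _
  have h := card_prime_pairs_le (Nat.sub_pos_of_lt hpow) heven hj
  have hratio : primeRatio (2 ^ k - 2 ^ l) ≤ 3 / 2 * primeRatio (2 ^ (k - l) - 1) := by
    rw [← hfac]
    refine (primeRatio_mul_le _ _).trans ?_
    gcongr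
    · exact zero_le_one.trans (one_le_primeRatio _)
    · exact primeRatio_two_pow_le l
  have hle : #{x ∈ oddPrimesBelow (2 ^ (24 * j)) ×ˢ oddPrimesBelow (2 ^ (24 * j)) |
      x.1 + 2 ^ k = x.2 + 2 ^ l} ≤
      #{p ∈ range (2 ^ (24 * j)) | p.Prime ∧ (p + (2 ^ k - 2 ^ l)).Prime} := by
    refine card_le_card_of_injOn Prod.fst (fun x hx => ?_) fun x hx y hy hxy => ?_
    · simp only [coe_filter, mem_product, mem_oddPrimesBelow, Set.mem_ofPred_eq] at hx
      obtain ⟨⟨⟨h1, h2, -⟩, -, h3, -⟩, h4⟩ := hx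
      simp only [coe_filter, mem_range, Set.mem_ofPred_eq]
      exact ⟨h1, h2, by rwa [show x.1 + (2 ^ k - 2 ^ l) = x.2 by omega]⟩
    · simp only [coe_filter, Set.mem_ofPred_eq] at hx hy
      refine Prod.ext hxy ?_
      have := hx.2
      have := hy.2
      omega
  calc _ ≤ _ := Nat.cast_le.mpr hle
    _ ≤ _ := h
    _ ≤ 32 * (3 / 2 * primeRatio (2 ^ (k - l) - 1)) * 2 ^ (24 * j) / j ^ 2 +
        3 * 2 ^ (12 * j) := by gcongr
    _ = _ := by ring

/-- Pairs of odd primes below `N` whose translates by `2 ^ k` and `2 ^ l` coincide. -/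
def collisions (N k l : ℕ) : Finset (ℕ × ℕ) :=
  {x ∈ oddPrimesBelow N ×ˢ oddPrimesBelow N | x.1 + 2 ^ k = x.2 + 2 ^ l}

lemma card_collisions_self (N k : ℕ) : #(collisions N k k) = #(oddPrimesBelow N) := by
  have h : collisions N k k = (oddPrimesBelow N).diag := by
    ext x
    simp only [collisions, mem_filter, mem_product, mem_diag, add_left_inj]
    constructor
    · rintro ⟨⟨h1, -⟩, h2⟩
      exact ⟨h1, h2⟩
    · rintro ⟨h1, h2⟩
      exact ⟨⟨h1, h2 ▸ h1⟩, h2⟩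
  rw [h, diag_card]

lemma card_collisions_comm (N k l : ℕ) : #(collisions N k l) = #(collisions N l k) := by
  refine card_bij' (fun x _ => x.swap) (fun x _ => x.swap) ?_ ?_ (fun _ _ => rfl) fun _ _ => rfl
  all_goals
    intro x hx
    simp only [collisions, mem_filter, mem_product, Prod.fst_swap, Prod.snd_swap] at hx ⊢
    exact ⟨hx.1.symm, hx.2.symm⟩

lemma sum_card_fiber_eq (N K : ℕ) :
    ∑ x ∈ oddPrimesBelow N ×ˢ Icc 1 K,
      #{y ∈ oddPrimesBelow N ×ˢ Icc 1 K | y.1 + 2 ^ y.2 = x.1 + 2 ^ x.2} =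
      ∑ k ∈ Icc 1 K, ∑ l ∈ Icc 1 K, #(collisions N k l) := by
  simp only [collisions, card_filter]
  rw [sum_product_right]
  refine sum_congr rfl fun k _ => ?_
  simp only [sum_product_right (s := oddPrimesBelow N) (t := Icc 1 K)]
  rw [sum_comm]
  refine sum_congr rfl fun l _ => ?_
  rw [sum_product]
  exact sum_congr rfl fun p _ => sum_congr rfl fun q _ => by simp only [eq_comm]

lemma card_collisions_le {j k l : ℕ} (hj : 0 < j) (hk : 0 < k) (hl : 0 < l) :
    (#(collisions (2 ^ (24 * j)) k l) : ℝ) ≤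
      (if k = l then (#(oddPrimesBelow (2 ^ (24 * j))) : ℝ) else 0) +
        48 * 2 ^ (24 * j) / j ^ 2 * ((if l < k then primeRatio (2 ^ (k - l) - 1) else 0) +
          if k < l then primeRatio (2 ^ (l - k) - 1) else 0) + 3 * 2 ^ (12 * j) := by
  rcases lt_trichotomy k l with h | rfl | h
  · have h1 := card_collisions_lt hj hk h
    rw [card_collisions_comm]
    simp only [h.ne, h.not_gt, h, if_false, if_true]
    refine h1.trans_eq ?_
    ring
  · rw [card_collisions_self]
    simp
  · have h1 := card_collisions_lt hj hl h
    simp only [h.ne', h.not_gt, h, if_false, if_true]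
    refine h1.trans_eq ?_
    ring

lemma sum_sub_le_sum {g : ℕ → ℝ} (hg : ∀ n, 0 ≤ g n) (K k : ℕ) (hk : k ∈ Icc 1 K) :
    ∑ l ∈ Icc 1 K, (if l < k then g (k - l) else 0) ≤ ∑ i ∈ Icc 1 K, g i := by
  rw [← sum_filter]
  have hinj : Set.InjOn (fun l => k - l) ({l ∈ Icc 1 K | l < k} : Finset ℕ) := by
    intro x hx y hy hxy
    simp only [coe_filter, Set.mem_ofPred_eq] at hx hy hxy
    omega
  rw [← sum_image (f := g) hinj]
  refine sum_le_sum_of_subset_of_nonneg (fun i hi => ?_) fun i _ _ => hg i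
  simp only [mem_image, mem_filter, mem_Icc] at hi hk ⊢
  omega

lemma exists_sum_card_collisions_le :
    ∃ D : ℝ, 0 < D ∧ ∀ j, 0 < j → ∑ k ∈ Icc 1 (24 * j), ∑ l ∈ Icc 1 (24 * j),
      (#(collisions (2 ^ (24 * j)) k l) : ℝ) ≤ D * 2 ^ (24 * j) := by
  obtain ⟨C, hC, h⟩ := exists_sum_primeRatio_le
  refine ⟨1848 + 55296 * C, by positivity, fun j hj => ?_⟩
  have hj0 : (0 : ℝ) < j := by exact_mod_cast hj
  set K := 24 * j with hK
  set N : ℝ := 2 ^ K with hN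
  set P : ℝ := ((#(oddPrimesBelow (2 ^ K)) : ℕ) : ℝ) with hP
  set Q : ℝ := 2 ^ (12 * j) with hQ
  set g : ℕ → ℝ := fun n => primeRatio (2 ^ n - 1) with hg
  have hg0 : ∀ n, 0 ≤ g n := fun n => zero_le_one.trans (one_le_primeRatio _)
  have hKr : (K : ℝ) = 24 * j := by rw [hK]; push_cast; rfl
  have hdiag : ∑ k ∈ Icc 1 K, ∑ l ∈ Icc 1 K, (if k = l then P else 0) = K * P := by
    rw [sum_congr rfl (g := fun _ => P) fun k hk => by rw [sum_ite_eq, if_pos hk]]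
    simp
  have hone : ∑ k ∈ Icc 1 K, ∑ l ∈ Icc 1 K, (if l < k then g (k - l) else 0) ≤ K * (C * K) := by
    calc _ ≤ ∑ _k ∈ Icc 1 K, C * (K : ℝ) :=
          sum_le_sum fun k hk => (sum_sub_le_sum hg0 K k hk).trans (h K)
      _ = _ := by simp
  have htwo : ∑ k ∈ Icc 1 K, ∑ l ∈ Icc 1 K, (if k < l then g (l - k) else 0) ≤ K * (C * K) := by
    rw [sum_comm]
    exact hone
  have hPle : P ≤ 2 * N / j + 3 * Q := card_oddPrimesBelow_le hj
  have hNQ : N = Q * Q := by rw [hN, hQ, hK, ← pow_add]; congr 1; ring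
  have hjQ : (j : ℝ) ^ 2 ≤ Q := by
    have h1 : j < 2 ^ j := Nat.lt_two_pow_self
    have h2 : (j : ℝ) ≤ 2 ^ j := by exact_mod_cast h1.le
    calc (j : ℝ) ^ 2 ≤ (2 ^ j) ^ 2 := by gcongr
      _ = 2 ^ (j * 2) := by rw [pow_mul]
      _ ≤ Q := pow_le_pow_right₀ one_le_two (by omega)
  have hjj : (j : ℝ) ≤ j ^ 2 := by
    have : (1 : ℝ) ≤ j := by exact_mod_cast hj
    nlinarith
  have hQ0 : 0 < Q := by positivity
  calc ∑ k ∈ Icc 1 K, ∑ l ∈ Icc 1 K, (#(collisions (2 ^ K) k l) : ℝ)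
      ≤ ∑ k ∈ Icc 1 K, ∑ l ∈ Icc 1 K, ((if k = l then P else 0) + 48 * N / j ^ 2 *
          ((if l < k then g (k - l) else 0) + if k < l then g (l - k) else 0) + 3 * Q) :=
        sum_le_sum fun k hk => sum_le_sum fun l hl =>
          card_collisions_le hj (mem_Icc.mp hk).1 (mem_Icc.mp hl).1
    _ = K * P + 48 * N / j ^ 2 *
          (∑ k ∈ Icc 1 K, ∑ l ∈ Icc 1 K, (if l < k then g (k - l) else 0) +
            ∑ k ∈ Icc 1 K, ∑ l ∈ Icc 1 K, (if k < l then g (l - k) else 0)) +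
          K * (K * (3 * Q)) := by
        simp only [sum_add_distrib, ← mul_sum, hdiag]
        simp
        ring
    _ ≤ K * (2 * N / j + 3 * Q) + 48 * N / j ^ 2 * (K * (C * K) + K * (C * K)) +
          K * (K * (3 * Q)) := by gcongr
    _ = 48 * N + 72 * (j * Q) + 55296 * C * N + 1728 * (j ^ 2 * Q) := by
        rw [hKr]
        field_simp
        ring
    _ ≤ 48 * N + 72 * N + 55296 * C * N + 1728 * N := by
        rw [hNQ]
        gcongr
        exact hjj.trans hjQ
    _ = _ := by ring

theorem exists_card_prime_add_two_pow_ge :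
    ∃ c : ℝ, 0 < c ∧ ∀ j, 0 < j → ∃ A : Finset ℕ, c * 2 ^ (24 * j) ≤ #A ∧
      ∀ n ∈ A, n ≤ 2 * 2 ^ (24 * j) ∧ Odd n ∧ ∃ p k, p.Prime ∧ 0 < k ∧ n = p + 2 ^ k := by
  obtain ⟨D, hD, h⟩ := exists_sum_card_collisions_le
  refine ⟨1 / (4 * D), by positivity, fun j hj => ?_⟩
  set K := 24 * j with hK
  set Ω := oddPrimesBelow (2 ^ K) ×ˢ Icc 1 K with hΩ
  refine ⟨Ω.image fun x => x.1 + 2 ^ x.2, ?_, fun n hn => ?_⟩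
  · have h1 := card_sq_le_card_image_mul Ω fun x => x.1 + 2 ^ x.2
    rw [hΩ, sum_card_fiber_eq, ← hΩ] at h1
    have h2 : (#Ω : ℝ) ^ 2 ≤ #(Ω.image fun x => x.1 + 2 ^ x.2) *
        ∑ k ∈ Icc 1 K, ∑ l ∈ Icc 1 K, (#(collisions (2 ^ K) k l) : ℝ) := by exact_mod_cast h1
    have h3 : (2 : ℝ) ^ K / 2 ≤ #Ω := by
      have h4 := two_pow_half_le_card_oddPrimesBelow (K := K) (by omega)
      rw [hΩ, card_product, Nat.card_Icc, Nat.add_sub_cancel, mul_comm]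
      exact_mod_cast h4
    set A : ℝ := ((#(Ω.image fun x => x.1 + 2 ^ x.2) : ℕ) : ℝ) with hA
    have hA0 : 0 ≤ A := by positivity
    have h5 : ((2 : ℝ) ^ K / 2) ^ 2 ≤ A * (D * 2 ^ K) :=
      (pow_le_pow_left₀ (by positivity) h3 2).trans (h2.trans (by gcongr; exact h j hj))
    rw [one_div_mul_eq_div, div_le_iff₀ (by positivity)]
    have h6 : (0 : ℝ) < 2 ^ K := by positivity
    refine le_of_mul_le_mul_right ?_ h6
    nlinarith
  · obtain ⟨⟨p, k⟩, hx, rfl⟩ := mem_image.mp hn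
    rw [hΩ, mem_product, mem_oddPrimesBelow, mem_Icc] at hx
    obtain ⟨⟨h1, h2, h3⟩, h4, h5⟩ := hx
    have h6 : 2 ^ k ≤ 2 ^ K := Nat.pow_le_pow_right two_pos h5
    dsimp only at h1 h2 h3 h4 ⊢
    exact ⟨by omega, (h2.odd_of_ne_two h3).add_even (even_two.pow_of_ne_zero (by omega)),
      p, k, h2, h4, rfl⟩

end Romanoff

section CoveringClass

open Finset

lemma exists_prime_dvd_two_pow_sub_one {e : ℕ} (he : e.Prime) (he2 : e ≠ 2) :
    ∃ q, q.Prime ∧ q ∣ 2 ^ e - 1 ∧ 2 * e < q := by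
  have h1 : 2 ^ e - 1 ≠ 1 := by
    have := Nat.pow_le_pow_right two_pos he.two_le
    omega
  obtain ⟨q, hq, hqe⟩ := Nat.exists_prime_and_dvd h1
  refine ⟨q, hq, hqe, ?_⟩
  have : Fact q.Prime := ⟨hq⟩
  have hodd : q ≠ 2 := by
    rintro rfl
    have h2 : 2 ∣ 2 ^ e := dvd_pow_self 2 he.ne_zero
    have h3 := (Nat.dvd_sub_iff_right Nat.one_le_two_pow h2).mp hqe
    omega
  have h2 : (2 : ZMod q) ≠ 0 := by
    intro h
    have h3 : q ∣ 2 := (ZMod.natCast_eq_zero_iff 2 q).mp (by exact_mod_cast h)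
    exact hodd ((Nat.prime_dvd_prime_iff_eq hq Nat.prime_two).mp h3)
  have hord : orderOf (2 : ZMod q) = e := by
    refine ((Nat.dvd_prime he).mp ((dvd_two_pow_sub_one_iff q e).mp hqe)).resolve_left fun h => ?_
    have h3 : q ∣ 2 ^ 1 - 1 := (dvd_two_pow_sub_one_iff q 1).mpr (by rw [h])
    exact hq.one_lt.ne' (Nat.dvd_one.mp h3)
  have h3 : e ∣ q - 1 := hord ▸ ZMod.orderOf_dvd_card_sub_one h2
  have h4 : 2 ∣ q - 1 := (hq.even_sub_one hodd).two_dvd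
  have h5 : 2 * e ∣ q - 1 :=
    ((Nat.coprime_primes Nat.prime_two he).mpr he2.symm).mul_dvd_of_dvd_of_dvd h4 h3
  have h6 := Nat.le_of_dvd (by have := hq.two_le; omega) h5
  have := hq.two_le
  omega

lemma exists_primes_sum_inv_ge (M : ℕ) (T : ℝ) :
    ∃ E : Finset ℕ, (∀ e ∈ E, e.Prime ∧ M < e) ∧ T ≤ ∑ e ∈ E, 1 / (e : ℝ) := by
  by_contra! hcon
  refine Nat.Primes.not_summable_one_div ?_
  refine summable_of_sum_le (c := T + ∑ n ∈ range (M + 1), 1 / (n : ℝ)) (fun p => by simp)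
    fun u => ?_
  have h1 : ∑ p ∈ u, 1 / (p : ℝ) = ∑ n ∈ u.image (fun p : Nat.Primes => (p : ℕ)),
      1 / (n : ℝ) := by
    exact (sum_image (f := fun n : ℕ => 1 / (n : ℝ)) fun x _ y _ h => Subtype.ext h).symm
  rw [h1, ← sum_filter_add_sum_filter_not _ (fun n => M < n)]
  refine add_le_add (hcon _ fun e he => ?_).le (sum_le_sum_of_subset_of_nonneg ?_ fun n _ _ => by
    positivity)
  · obtain ⟨h2, h3⟩ := mem_filter.mp he
    obtain ⟨p, -, rfl⟩ := mem_image.mp h2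
    exact ⟨p.2, h3⟩
  · intro n hn
    have := (mem_filter.mp hn).2
    rw [mem_range]
    omega

lemma primeRatio_prod_le {ι : Type*} (s : Finset ι) (f : ι → ℕ) :
    primeRatio (∏ i ∈ s, f i) ≤ ∏ i ∈ s, primeRatio (f i) := by
  classical
  induction s using Finset.induction_on with
  | empty => simp [primeRatio]
  | insert a s ha ih =>
    rw [prod_insert ha, prod_insert ha]
    refine (primeRatio_mul_le _ _).trans ?_
    gcongr
    exact zero_le_one.trans (one_le_primeRatio _)

lemma totient_prod_primes {E : Finset ℕ} (hE : ∀ e ∈ E, e.Prime) :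
    (Nat.totient (∏ e ∈ E, e) : ℝ) = (∏ e ∈ E, e : ℕ) * ∏ e ∈ E, (1 - 1 / (e : ℝ)) := by
  have h := Nat.totient_eq_mul_prod_factors (∏ e ∈ E, e)
  rw [Nat.primeFactors_prod hE] at h
  have h1 := congrArg (fun x : ℚ => (x : ℝ)) h
  push_cast at h1 ⊢
  simpa only [one_div] using h1

lemma one_sub_mul_primeRatio_le {e q : ℕ} (he : 0 < e) (hq : q.Prime) (heq : 2 * e < q) :
    (1 - 1 / (e : ℝ)) * primeRatio q ≤ Real.exp (-(1 / e) / 2) := by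
  have he0 : (0 : ℝ) < e := by exact_mod_cast he
  have he1 : (1 : ℝ) ≤ e := by exact_mod_cast he
  have h1 : 1 / (q : ℝ) ≤ 1 / e / 2 := by
    rw [div_div]
    refine one_div_le_one_div_of_le (by positivity) ?_
    have : (2 * e : ℝ) < q := by exact_mod_cast heq
    linarith
  have h2 : 0 ≤ 1 - 1 / (e : ℝ) := by
    rw [sub_nonneg, div_le_one he0]
    exact he1
  have h3 : primeRatio q ≤ 1 + 1 / (e : ℝ) / 2 := by
    rw [primeRatio, hq.primeFactors, prod_singleton]
    linarith
  have h4 := Real.add_one_le_exp (-(1 / (e : ℝ)) / 2)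
  have h5 : 0 < 1 / (e : ℝ) := by positivity
  calc _ ≤ (1 - 1 / (e : ℝ)) * (1 + 1 / (e : ℝ) / 2) := by gcongr
    _ ≤ _ := by nlinarith

lemma exists_class_data (M r : ℕ) (hM : 0 < M) {δ : ℝ} (hδ : 0 < δ) :
    ∃ (E : Finset ℕ) (q : ℕ → ℕ) (M' r' : ℕ), (∀ e ∈ E, e.Prime ∧ (q e).Prime ∧
      q e ∣ 2 ^ e - 1 ∧ q e ∣ M' ∧ r' ≡ 1 [MOD q e]) ∧ 0 < M' ∧ r' < M' ∧ M ∣ M' ∧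
      r' ≡ r [MOD M] ∧
      Nat.totient (∏ e ∈ E, e) * primeRatio M' ≤ δ * (∏ e ∈ E, e : ℕ) := by
  choose! q hq hqd hqe using fun (e : ℕ) (he : e.Prime ∧ e ≠ 2) =>
    exists_prime_dvd_two_pow_sub_one he.1 he.2
  obtain ⟨T, hT⟩ : ∃ T : ℝ, primeRatio M * Real.exp (-T / 2) ≤ δ := by
    have hpos : 0 < primeRatio M := zero_lt_one.trans_le (one_le_primeRatio M)
    refine ⟨-2 * Real.log (δ / primeRatio M), ?_⟩
    rw [show -(-2 * Real.log (δ / primeRatio M)) / 2 = Real.log (δ / primeRatio M) by ring,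
      Real.exp_log (by positivity), mul_div_cancel₀ _ hpos.ne']
  obtain ⟨E, hE, hET⟩ := exists_primes_sum_inv_ge (M + 2) T
  have hE' : ∀ e ∈ E, e.Prime ∧ e ≠ 2 := fun e he => ⟨(hE e he).1, by have := (hE e he).2; omega⟩
  have hcop : M.Coprime (∏ e ∈ E, q e) := Nat.Coprime.prod_right fun e he => by
    refine ((hq e (hE' e he)).coprime_iff_not_dvd.mpr fun h => ?_).symm
    have h1 := Nat.le_of_dvd hM h
    have h2 := hqe e (hE' e he)
    have h3 := (hE e he).2
    omega
  have hQ : ∏ e ∈ E, q e ≠ 0 := prod_ne_zero_iff.mpr fun e he => (hq e (hE' e he)).ne_zero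
  obtain ⟨h1, h2⟩ := (Nat.chineseRemainder hcop r 1).2
  refine ⟨E, q, M * ∏ e ∈ E, q e, Nat.chineseRemainder hcop r 1, fun e he => ?_,
    Nat.pos_of_ne_zero (mul_ne_zero hM.ne' hQ),
    Nat.chineseRemainder_lt_mul hcop r 1 hM.ne' hQ, dvd_mul_right _ _, h1, ?_⟩
  · exact ⟨(hE' e he).1, hq e (hE' e he), hqd e (hE' e he),
      (dvd_prod_of_mem q he).mul_left _, h2.of_dvd (dvd_prod_of_mem q he)⟩
  · rw [totient_prod_primes fun e he => (hE e he).1, mul_comm δ, mul_assoc]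
    refine mul_le_mul_of_nonneg_left ?_ (Nat.cast_nonneg _)
    have h0 : 0 ≤ ∏ e ∈ E, (1 - 1 / (e : ℝ)) := prod_nonneg fun e he => by
      have h3 : (1 : ℝ) ≤ e := by exact_mod_cast (hE e he).1.one_le
      rw [sub_nonneg, div_le_one (by linarith)]
      exact h3
    have hM0 : 0 ≤ primeRatio M := zero_le_one.trans (one_le_primeRatio M)
    calc (∏ e ∈ E, (1 - 1 / (e : ℝ))) * primeRatio (M * ∏ e ∈ E, q e)
        ≤ (∏ e ∈ E, (1 - 1 / (e : ℝ))) * (primeRatio M * ∏ e ∈ E, primeRatio (q e)) := by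
          gcongr
          refine (primeRatio_mul_le _ _).trans ?_
          gcongr
          exact primeRatio_prod_le E q
      _ = primeRatio M * ∏ e ∈ E, ((1 - 1 / (e : ℝ)) * primeRatio (q e)) := by
          rw [prod_mul_distrib]
          ring
      _ ≤ primeRatio M * ∏ e ∈ E, Real.exp (-(1 / e) / 2) := by
          gcongr with e he
          · intro e he
            have h3 : (1 : ℝ) ≤ e := by exact_mod_cast (hE e he).1.one_le
            refine mul_nonneg ?_ (zero_le_one.trans (one_le_primeRatio _))
            rw [sub_nonneg, div_le_one (by linarith)]
            exact h3
          · exact one_sub_mul_primeRatio_le (hE' e he).1.pos (hq e (hE' e he)) (hqe e (hE' e he))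
      _ = primeRatio M * Real.exp (-(∑ e ∈ E, 1 / (e : ℝ)) / 2) := by
          rw [← Real.exp_sum, ← sum_div, sum_neg_distrib]
      _ ≤ primeRatio M * Real.exp (-T / 2) := by gcongr
      _ ≤ δ := hT

lemma card_filter_coprime_le {L K : ℕ} (hL : L ≠ 0) :
    (#{k ∈ range K | L.Coprime k} : ℝ) ≤ Nat.totient L * (K / L + 1) := by
  have h := Nat.Ico_filter_coprime_le 0 K hL
  rw [zero_add, ← range_eq_Ico] at h
  calc (#{k ∈ range K | L.Coprime k} : ℝ) ≤ (Nat.totient L * (K / L + 1) : ℕ) := by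
        exact_mod_cast h
    _ ≤ _ := by
        push_cast
        gcongr
        exact Nat.cast_div_le

theorem exists_class_few_prime_add_two_pow (M r : ℕ) (hM : 0 < M) :
    ∃ M' r', 0 < M' ∧ r' < M' ∧ M ∣ M' ∧ r' ≡ r [MOD M] ∧ ∃ j₀, ∀ j, j₀ ≤ j →
      ∃ B : Finset ℕ, (#B : ℝ) ≤ 2 ^ (24 * j) / 2 ∧ ∀ n, n < M' * 2 ^ (24 * j) → n % M' = r' →
        (∃ p k, p.Prime ∧ 0 < k ∧ n = p + 2 ^ k) → n ∈ B := by
  obtain ⟨E, q, M', r', hE, hM', hr', hMM', hrr', hδ⟩ :=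
    exists_class_data M r hM (δ := 1 / 200) (by norm_num)
  refine ⟨M', r', hM', hr', hMM', hrr', ?_⟩
  set L := ∏ e ∈ E, e with hL
  have hL0 : L ≠ 0 := prod_ne_zero_iff.mpr fun e he => (hE e he).1.ne_zero
  refine ⟨M' + L + (100 * #E + 300), fun j hj => ?_⟩
  have hj0 : 0 < j := by omega
  set N := 2 ^ (24 * j) with hN
  set K := 24 * j + M' with hK
  set P : ℕ → Finset ℕ := fun k =>
    {p ∈ range (M' * N) | p.Prime ∧ p % M' = (r' + M' * 2 ^ k - 2 ^ k) % M'} with hP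
  refine ⟨(E ×ˢ range K).image (fun x => q x.1 + 2 ^ x.2) ∪
    {k ∈ range K | L.Coprime k}.biUnion (fun k => (P k).image (fun p => p + 2 ^ k)), ?_, ?_⟩
  · set F : Finset ℕ := {k ∈ range K | L.Coprime k} with hF
    set b := primeRatio M' with hb
    have hb1 : 1 ≤ b := one_le_primeRatio M'
    set Q : ℝ := 2 ^ (12 * j) with hQ
    set a : ℝ := ((Nat.totient L : ℕ) : ℝ) with ha
    have ha0 : 0 ≤ a := Nat.cast_nonneg _
    have hc1 : #((E ×ˢ range K).image (fun x => q x.1 + 2 ^ x.2)) ≤ #E * K := by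
      refine card_image_le.trans ?_
      rw [card_product, card_range]
    have hc2 : #(F.biUnion (fun k => (P k).image (fun p => p + 2 ^ k))) ≤ ∑ k ∈ F, #(P k) :=
      card_biUnion_le.trans (sum_le_sum fun k _ => card_image_le)
    have hNQ : (N : ℝ) = Q * Q := by
      rw [hN, hQ, ← pow_add]; push_cast; congr 1; ring
    have hPk : ∀ k, (#(P k) : ℝ) ≤ 2 * b * N / j + 3 * Q := fun k => by
      have h := card_primes_mod_eq_le hM' ((r' + M' * 2 ^ k - 2 ^ k) % M') hj0
      rw [hN]
      push_cast
      exact h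
    have hc3 : (∑ k ∈ F, #(P k) : ℕ) ≤ a * (K / L + 1) * (2 * b * N / j + 3 * Q) := by
      push_cast
      calc ∑ k ∈ F, (#(P k) : ℝ) ≤ ∑ _k ∈ F, (2 * b * N / j + 3 * Q) :=
            sum_le_sum fun k _ => hPk k
        _ = #F * (2 * b * N / j + 3 * Q) := by rw [sum_const, nsmul_eq_mul]
        _ ≤ _ := by
            gcongr
            exact card_filter_coprime_le hL0
    have hjr : (0 : ℝ) < j := by exact_mod_cast hj0
    have hLr : (0 : ℝ) < L := by exact_mod_cast Nat.pos_of_ne_zero hL0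
    have hjr' : (M' + L + (100 * #E + 300) : ℝ) ≤ j := by exact_mod_cast hj
    have hKL : (K / L + 1 : ℝ) ≤ 25 * j / L := by
      rw [div_add_one hLr.ne']
      gcongr
      rw [hK]
      push_cast
      have : (0 : ℝ) ≤ #E := Nat.cast_nonneg _
      linarith
    have hKj : (K : ℝ) ≤ 25 * j := by
      rw [hK]
      push_cast
      have : (0 : ℝ) ≤ #E := Nat.cast_nonneg _
      linarith
    have haL : a / L ≤ 1 := by
      rw [div_le_one hLr]
      exact Nat.cast_le.mpr (Nat.totient_le L)
    have habL : a * b / L ≤ 1 / 200 := by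
      rw [div_le_iff₀ hLr]
      exact hδ
    have hjQ : (j : ℝ) ^ 2 ≤ Q := by
      have h2 : (j : ℝ) ≤ 2 ^ j := by exact_mod_cast (Nat.lt_two_pow_self (n := j)).le
      calc (j : ℝ) ^ 2 ≤ (2 ^ j) ^ 2 := by gcongr
        _ = 2 ^ (j * 2) := by rw [pow_mul]
        _ ≤ Q := pow_le_pow_right₀ one_le_two (by omega)
    have hQ1 : 1 ≤ Q := one_le_pow₀ one_le_two
    have hN' : (2 : ℝ) ^ (24 * j) = N := by rw [hN]; push_cast; rfl
    rw [hN']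
    calc _ ≤ ((#E * K + ∑ k ∈ F, #(P k) : ℕ) : ℝ) :=
          Nat.cast_le.mpr ((card_union_le _ _).trans (add_le_add hc1 hc2))
      _ ≤ #E * K + a * (K / L + 1) * (2 * b * N / j + 3 * Q) := by
          rw [Nat.cast_add, Nat.cast_mul]
          gcongr
      _ ≤ #E * (25 * j) + a * (25 * j / L) * (2 * b * N / j + 3 * Q) := by gcongr
      _ = #E * (25 * j) * 1 + 50 * (a * b / L) * N + 75 * (a / L) * (j * Q) := by
          field_simp
          ring
      _ ≤ #E * (25 * j) * Q + 50 * (1 / 200) * N + 75 * 1 * (j * Q) := by gcongr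
      _ = (25 * #E + 75) * j * Q + N / 4 := by ring
      _ ≤ (j / 4) * j * Q + N / 4 := by
          gcongr
          have : (0 : ℝ) ≤ M' := Nat.cast_nonneg _
          linarith
      _ = j ^ 2 * Q / 4 + N / 4 := by ring
      _ ≤ Q * Q / 4 + N / 4 := by gcongr
      _ = N / 2 := by rw [hNQ]; ring
  · rintro n hn hnr ⟨p, k, hp, hk, rfl⟩
    have hkK : k < K := by
      refine (Nat.pow_lt_pow_iff_right one_lt_two).mp ?_
      calc 2 ^ k < M' * N := by omega
        _ ≤ 2 ^ M' * N := Nat.mul_le_mul_right _ Nat.lt_two_pow_self.le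
        _ = 2 ^ K := by rw [hN, hK, ← pow_add, add_comm]
    have hmod : p + 2 ^ k ≡ r' [MOD M'] := by rw [Nat.ModEq, hnr, Nat.mod_eq_of_lt hr']
    rw [mem_union]
    by_cases hex : ∃ e ∈ E, e ∣ k
    · obtain ⟨e, he, hek⟩ := hex
      obtain ⟨-, hq, hqe, hqM, hqr⟩ := hE e he
      left
      refine mem_image.mpr ⟨(e, k), mem_product.mpr ⟨he, mem_range.mpr hkK⟩, ?_⟩
      have h1 : 2 ^ k ≡ 1 [MOD q e] := by
        refine ((Nat.modEq_iff_dvd' Nat.one_le_two_pow).mpr ?_).symm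
        rw [dvd_two_pow_sub_one_iff] at hqe ⊢
        exact hqe.trans hek
      have h2 : p + 2 ^ k ≡ 0 + 2 ^ k [MOD q e] := by
        rw [zero_add]
        exact ((hmod.of_dvd hqM).trans hqr).trans h1.symm
      have h3 : q e ∣ p := (Nat.modEq_zero_iff_dvd).mp (Nat.ModEq.add_right_cancel' _ h2)
      rw [(Nat.prime_dvd_prime_iff_eq hq hp).mp h3]
    · push Not at hex
      right
      refine mem_biUnion.mpr ⟨k, mem_filter.mpr ⟨mem_range.mpr hkK, ?_⟩,
        mem_image.mpr ⟨p, mem_filter.mpr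
          ⟨mem_range.mpr ((Nat.le_add_right _ _).trans_lt hn), hp, ?_⟩, rfl⟩⟩
      · exact (Nat.Coprime.prod_right fun e he =>
          ((hE e he).1.coprime_iff_not_dvd.mpr (hex e he)).symm).symm
      · have h4 : 2 ^ k ≤ M' * 2 ^ k := Nat.le_mul_of_pos_left _ hM'
        refine Nat.ModEq.add_right_cancel' (2 ^ k) (hmod.trans ?_)
        rw [Nat.sub_add_cancel (by omega)]
        exact (Nat.modEq_iff_dvd' (by omega)).mpr (by simp)

end CoveringClass

section UnionOfProgressions

open Finset

lemma DensityZero.exists_card_le {S : Set ℕ} (hS : DensityZero S) {D : ℕ} (hD : 0 < D) {ε : ℝ}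
    (hε : 0 < ε) : ∃ j₀, ∀ j, j₀ ≤ j → ∀ T : Finset ℕ,
      (∀ n ∈ T, n ∈ S ∧ 0 < n ∧ n ≤ D * 2 ^ (24 * j)) → (#T : ℝ) ≤ ε * 2 ^ (24 * j) := by
  have hD' : (0 : ℝ) < D := by exact_mod_cast hD
  have hlim : Tendsto (fun j : ℕ => D * 2 ^ (24 * j)) atTop atTop := by
    refine tendsto_atTop_mono (fun j => ?_) tendsto_id
    calc j ≤ 2 ^ j := Nat.lt_two_pow_self.le
      _ ≤ 2 ^ (24 * j) := Nat.pow_le_pow_right two_pos (by omega)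
      _ ≤ D * 2 ^ (24 * j) := Nat.le_mul_of_pos_left _ hD
  obtain ⟨j₀, hj₀⟩ := eventually_atTop.mp
    ((hS.comp hlim).eventually_lt_const (div_pos hε hD'))
  refine ⟨j₀, fun j hj T hT => ?_⟩
  have h1 := hj₀ j hj
  simp only [Function.comp_apply] at h1
  rw [div_lt_iff₀ (by exact_mod_cast Nat.mul_pos hD (by positivity))] at h1
  have h2 : #T ≤ Nat.card ↥(S ∩ Set.Icc 1 (D * 2 ^ (24 * j))) := by
    rw [Nat.card_coe_set_eq, ← Set.ncard_coe_finset]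
    exact Set.ncard_le_ncard (fun n hn => ⟨(hT n hn).1, (hT n hn).2⟩)
      ((Set.finite_Icc _ _).inter_of_right _)
  calc (#T : ℝ) ≤ Nat.card ↥(S ∩ Set.Icc 1 (D * 2 ^ (24 * j))) := by exact_mod_cast h2
    _ ≤ ε / D * (D * 2 ^ (24 * j) : ℕ) := h1.le
    _ = ε * 2 ^ (24 * j) := by
      push_cast
      field_simp

lemma mem_AP_iff {m a n : ℕ} : n ∈ AP m a ↔ a ≤ n ∧ n ≡ a [MOD m] := by
  constructor
  · rintro ⟨h, rfl⟩
    exact ⟨Nat.le_add_left _ _, by simp [Nat.ModEq]⟩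
  · rintro ⟨h1, h2⟩
    obtain ⟨h, hh⟩ := (Nat.modEq_iff_dvd' h1).mp h2.symm
    exact ⟨h, by omega⟩

lemma not_densityZero_of_eventually_odd_mem {S : Set ℕ} {n₀ : ℕ}
    (h : ∀ n, n₀ ≤ n → Odd n → n ∈ U ∪ S) : ¬ DensityZero S := by
  intro hS
  obtain ⟨c, hc, hA⟩ := exists_card_prime_add_two_pow_ge
  obtain ⟨j₀, hj₀⟩ := hS.exists_card_le two_pos (half_pos (half_pos hc))
  obtain ⟨j₁, hj₁⟩ := exists_nat_gt (4 * n₀ / c)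
  set j := j₀ + j₁ + 1 with hj
  obtain ⟨A, hcard, hA⟩ := hA j (by omega)
  have h1 := hj₀ j (by omega) {n ∈ A | n₀ ≤ n} fun n hn => by
    obtain ⟨hnA, hn₀⟩ := mem_filter.mp hn
    obtain ⟨hle, hodd, hrep⟩ := hA n hnA
    exact ⟨(h n hn₀ hodd).resolve_left fun hU => hU.2.2 hrep, hodd.pos, hle⟩
  have h2 : #A ≤ #{n ∈ A | n₀ ≤ n} + n₀ := by
    rw [← card_filter_add_card_filter_not (s := A) (fun n => n₀ ≤ n)]
    gcongr
    calc _ ≤ #(range n₀) := card_le_card fun n hn => by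
          have := (mem_filter.mp hn).2
          rw [mem_range]
          omega
      _ = n₀ := card_range n₀
  have h3 : (#A : ℝ) ≤ #{n ∈ A | n₀ ≤ n} + n₀ := by exact_mod_cast h2
  have h4 : (j : ℝ) ≤ 2 ^ (24 * j) := by
    exact_mod_cast (Nat.lt_two_pow_self (n := j)).le.trans
      (Nat.pow_le_pow_right two_pos (by omega))
  have h5 : (j₁ : ℝ) ≤ j := by exact_mod_cast (by omega : j₁ ≤ j)
  rw [div_lt_iff₀ hc] at hj₁
  nlinarith

lemma not_densityZero_of_odd_class {W : Set ℕ} {M r : ℕ} (hM : 0 < M) (h2 : 2 ∣ M) (hr : Odd r)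
    (h : ∀ n ∈ U, n ≡ r [MOD M] → n ∈ W) : ¬ DensityZero W := by
  intro hW
  obtain ⟨M', r', hM', hr', hMM', hrr', j₁, hj₁⟩ := exists_class_few_prime_add_two_pow M r hM
  obtain ⟨j₀, hj₀⟩ := hW.exists_card_le hM' (ε := 1 / 4) (by norm_num)
  obtain ⟨B, hB, hBmem⟩ := hj₁ (j₀ + j₁) (by omega)
  set N := 2 ^ (24 * (j₀ + j₁)) with hN
  set C := (range N).image (fun x => M' * x + r') with hC
  have hcard : #C = N := by
    rw [hC, card_image_of_injective, card_range]
    intro x y hxy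
    exact Nat.eq_of_mul_eq_mul_left hM' (Nat.add_right_cancel hxy)
  have h1 := hj₀ (j₀ + j₁) (by omega) (C \ B) fun n hn => by
    obtain ⟨hnC, hnB⟩ := mem_sdiff.mp hn
    obtain ⟨x, hx, rfl⟩ := mem_image.mp hnC
    have hlt : M' * x + r' < M' * N := by
      calc M' * x + r' < M' * (x + 1) := by rw [mul_add_one]; omega
        _ ≤ M' * N := Nat.mul_le_mul_left _ (mem_range.mp hx)
    have hmod : (M' * x + r') % M' = r' := by rw [Nat.mul_add_mod, Nat.mod_eq_of_lt hr']
    have hmodM : M' * x + r' ≡ r [MOD M] := by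
      refine Nat.ModEq.trans (Nat.ModEq.of_dvd hMM' ?_) hrr'
      rw [Nat.ModEq, hmod, Nat.mod_eq_of_lt hr']
    have hodd : Odd (M' * x + r') := by
      rw [Nat.odd_iff] at hr ⊢
      exact Eq.trans (hmodM.of_dvd h2) hr
    exact ⟨h _ ⟨hodd.pos, hodd, fun hrep => hnB (hBmem _ hlt hmod hrep)⟩ hmodM, hodd.pos, hlt.le⟩
  have h3 : #C ≤ #(C \ B) + #B := by
    have := le_card_sdiff B C
    omega
  have h4 : (N : ℝ) ≤ #(C \ B) + #B := by
    rw [hcard] at h3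
    exact_mod_cast h3
  have h5 : (N : ℝ) = 2 ^ (24 * (j₀ + j₁)) := by rw [hN]; push_cast; rfl
  have h6 : (0 : ℝ) < 2 ^ (24 * (j₀ + j₁)) := by positivity
  linarith

end UnionOfProgressions

theorem stmt0 (S : Set ℕ) (hSpos : ∀ n ∈ S, 0 < n) (hSd : DensityZero S) :
    ¬ ∃ (t : ℕ) (m a : Fin t → ℕ) (W : Set ℕ),
      (∀ i, 0 < m i) ∧ (∀ i, 0 < a i) ∧ (∀ n ∈ W, 0 < n) ∧ DensityZero W ∧
      U ∪ S = (⋃ i, AP (m i) (a i)) ∪ W := by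
  rintro ⟨t, m, a, W, hm, -, -, hW, hU⟩
  by_cases hcov : ∀ r, Odd r → ∃ i, r ≡ a i [MOD m i]
  · refine not_densityZero_of_eventually_odd_mem (n₀ := ∑ i, a i) (fun n hn hodd => ?_) hSd
    obtain ⟨i, hi⟩ := hcov n hodd
    rw [hU]
    exact Or.inl (Set.mem_iUnion.mpr ⟨i, mem_AP_iff.mpr
      ⟨(Finset.single_le_sum (fun _ _ => Nat.zero_le _) (Finset.mem_univ i)).trans hn, hi⟩⟩)
  · push Not at hcov
    obtain ⟨r, hr, hra⟩ := hcov
    refine not_densityZero_of_odd_class (M := 2 * ∏ i, m i)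
      (Nat.mul_pos two_pos (Finset.prod_pos fun i _ => hm i)) (dvd_mul_right _ _) hr
      (fun n hn hnr => ?_) hW
    have hn' : n ∈ (⋃ i, AP (m i) (a i)) ∪ W := hU ▸ Or.inl hn
    refine hn'.resolve_left fun hAP => ?_
    obtain ⟨i, hi⟩ := Set.mem_iUnion.mp hAP
    exact hra i ((hnr.of_dvd ((Finset.dvd_prod_of_mem m (Finset.mem_univ i)).mul_left 2)).symm.trans
      (mem_AP_iff.mp hi).2)
end

section
/- The set 𝒰 cannot be written as the union of finitely many infinite arithmetic progressions {m_i h + a_i : h = 0, 1, 2, …} (with m_i, a_i positive integers, 1 ≤ i ≤ t) together with a set W of positive integers of asymptotic density zero. -/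
open Filter

open Topology
open scoped ENNReal

/-- The sum of `n ^ (-s)` over the elements `n` of a set of natural numbers. -/
noncomputable def rpowSum (S : Set ℕ) (s : ℝ) : ℝ≥0∞ :=
  ∑' n : S, ENNReal.ofReal ((n : ℝ) ^ (-s))

lemma rpowSum_mono {S T : Set ℕ} (h : S ⊆ T) (s : ℝ) : rpowSum S s ≤ rpowSum T s :=
  ENNReal.tsum_mono_subtype (fun n : ℕ => ENNReal.ofReal ((n : ℝ) ^ (-s))) h

lemma rpowSum_union_le (S T : Set ℕ) (s : ℝ) : rpowSum (S ∪ T) s ≤ rpowSum S s + rpowSum T s :=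
  ENNReal.tsum_union_le (fun n : ℕ => ENNReal.ofReal ((n : ℝ) ^ (-s))) S T

lemma rpowSum_biUnion_le (P : Set ℕ) (t : ℕ → Set ℕ) (s : ℝ) :
    rpowSum (⋃ p ∈ P, t p) s ≤ ∑' p : P, rpowSum (t p) s :=
  ENNReal.tsum_biUnion_le_tsum (fun n : ℕ => ENNReal.ofReal ((n : ℝ) ^ (-s))) P t

lemma indicator_div_rpow_nonneg (S : Set ℕ) (s : ℝ) (n : ℕ) :
    0 ≤ S.indicator (1 : ℕ → ℝ) n / (n : ℝ) ^ s :=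
  div_nonneg (Set.indicator_nonneg (fun _ _ => zero_le_one) _) (by positivity)

lemma rpowSum_eq_ofReal (S : Set ℕ) {s : ℝ} (hs : 1 < s) :
    rpowSum S s = ENNReal.ofReal (∑' n : ℕ, S.indicator 1 n / (n : ℝ) ^ s) := by
  rw [rpowSum, tsum_subtype S fun n : ℕ => ENNReal.ofReal ((n : ℝ) ^ (-s)),
    ENNReal.ofReal_tsum_of_nonneg (indicator_div_rpow_nonneg S s)]
  · refine tsum_congr fun n => ?_
    by_cases hn : n ∈ S <;> simp [hn, Real.rpow_neg]
  · refine Summable.of_nonneg_of_le (indicator_div_rpow_nonneg S s) (fun n => ?_)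
      (Real.summable_one_div_nat_rpow.mpr hs)
    gcongr
    exact Set.indicator_le_self' (fun _ _ => zero_le_one) n

lemma rpowSum_ne_top (S : Set ℕ) {s : ℝ} (hs : 1 < s) : rpowSum S s ≠ ∞ := by
  simp [rpowSum_eq_ofReal S hs]

lemma tendsto_sub_mul_rpowSum {S : Set ℕ} {l : ℝ}
    (h : Tendsto (fun N : ℕ => (Nat.card ↥(S ∩ Set.Icc 1 N) : ℝ) / N) atTop (𝓝 l)) :
    Tendsto (fun s : ℝ => (s - 1) * (rpowSum S s).toReal) (𝓝[>] 1) (𝓝 l) := by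
  classical
  have hcard (N : ℕ) :
      ∑ k ∈ Finset.Icc 1 N, S.indicator (1 : ℕ → ℝ) k = Nat.card ↥(S ∩ Set.Icc 1 N) := by
    have : S ∩ Set.Icc 1 N = ↑({k ∈ Finset.Icc 1 N | k ∈ S} : Finset ℕ) := by
      ext; simp; tauto
    rw [this, Nat.card_eq_card_toFinset]
    simp [Set.indicator_apply]
  have key := LSeries_tendsto_sub_mul_nhds_one_of_tendsto_sum_div_and_nonneg
    (S.indicator 1) (h.congr fun N => by rw [hcard])
    (Set.indicator_nonneg fun _ _ => zero_le_one)
  rw [← tendsto_ofReal_iff]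
  refine key.congr' ?_
  filter_upwards [self_mem_nhdsWithin] with s hs
  rw [Set.mem_Ioi] at hs
  rw [rpowSum_eq_ofReal S hs, ENNReal.toReal_ofReal
    (tsum_nonneg (indicator_div_rpow_nonneg S s)), LSeries]
  push_cast
  congr 1
  refine tsum_congr fun n => ?_
  rcases eq_or_ne n 0 with rfl | hn
  · simp [Real.zero_rpow (by linarith : s ≠ 0)]
  · rw [LSeries.term_of_ne_zero hn, Complex.ofReal_cpow (Nat.cast_nonneg n)]
    simp

lemma tendsto_card_modEq_div {M : ℕ} (hM : 0 < M) (c : ℕ) :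
    Tendsto (fun N : ℕ => (Nat.card ↥({n | n ≡ c [MOD M]} ∩ Set.Icc 1 N) : ℝ) / N) atTop
      (𝓝 (M : ℝ)⁻¹) := by
  have hbound (N : ℕ) :
      |(Nat.card ↥({n | n ≡ c [MOD M]} ∩ Set.Icc 1 N) : ℝ) - N / M| ≤ 1 := by
    have hset : {n | n ≡ c [MOD M]} ∩ Set.Icc 1 N =
        ↑({n ∈ Finset.Ioc 0 N | n ≡ c [MOD M]} : Finset ℕ) := by
      ext n; simp [and_comm, Nat.pos_iff_ne_zero, Nat.one_le_iff_ne_zero]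
    have hcard := Nat.Ioc_filter_modEq_card 0 N hM c
    rw [hset, Nat.card_eq_card_toFinset, Finset.toFinset_coe]
    set A := ((N : ℚ) - c) / M
    set B := (((0 : ℕ) : ℚ) - c) / M
    have hAB : A - B = N / M := by simp only [A, B]; push_cast; ring
    have hN : (0 : ℚ) ≤ N / M := by positivity
    have hle : ⌊B⌋ ≤ ⌊A⌋ := Int.floor_le_floor (by linarith)
    rw [max_eq_left (by linarith)] at hcard
    have hq : |((⌊A⌋ - ⌊B⌋ : ℤ) : ℚ) - N / M| ≤ 1 := by
      rw [abs_le]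
      push_cast
      constructor <;>
        linarith [Int.floor_le A, Int.lt_floor_add_one A, Int.floor_le B, Int.lt_floor_add_one B]
    rw [← hcard] at hq
    have hr := (Rat.cast_le (K := ℝ)).mpr hq
    push_cast at hr
    exact hr
  rw [tendsto_iff_norm_sub_tendsto_zero]
  refine squeeze_zero' (Eventually.of_forall fun _ => norm_nonneg _) ?_
    (tendsto_one_div_atTop_nhds_zero_nat (𝕜 := ℝ))
  filter_upwards [eventually_gt_atTop 0] with N hN
  have hN' : (0 : ℝ) < N := by exact_mod_cast hN
  have hM' : (0 : ℝ) < M := by exact_mod_cast hM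
  calc ‖(Nat.card ↥({n | n ≡ c [MOD M]} ∩ Set.Icc 1 N) : ℝ) / N - (M : ℝ)⁻¹‖
      = |(Nat.card ↥({n | n ≡ c [MOD M]} ∩ Set.Icc 1 N) : ℝ) - N / M| / N := by
        rw [Real.norm_eq_abs, ← abs_of_pos hN', ← abs_div, abs_of_pos hN']
        congr 1
        field_simp
    _ ≤ 1 / N := by gcongr; exact hbound N

/-- A bound for the sum of `n ^ (-s)` over a shifted geometric progression. -/
lemma tsum_add_two_pow_le {x r : ℕ} (hx : 0 < x) (hr : 0 < r) {s : ℝ} (hs : 1 ≤ s) :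
    ∑' j : ℕ, ENNReal.ofReal (((x + 2 ^ (r * j) : ℕ) : ℝ) ^ (-s)) ≤
      ENNReal.ofReal ((x : ℝ) ^ (-s) * (Real.logb 2 x / r + 3)) := by
  have hx' : (0 : ℝ) < x := by exact_mod_cast hx
  have hr' : (0 : ℝ) < r := by exact_mod_cast hr
  set J := Nat.log 2 x / r + 1
  have hJ : (J : ℝ) ≤ Real.logb 2 x / r + 1 := by
    have h1 : ((Nat.log 2 x / r : ℕ) : ℝ) ≤ (Nat.log 2 x : ℝ) / r := Nat.cast_div_le
    have h2 : (Nat.log 2 x : ℝ) ≤ Real.logb 2 x := by exact_mod_cast Real.natLog_le_logb x 2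
    have h3 : (Nat.log 2 x : ℝ) / r ≤ Real.logb 2 x / r := by gcongr
    simp only [J]
    push_cast
    linarith
  have hpow (i : ℕ) : 2 ^ i * x ≤ 2 ^ (r * (i + J)) := by
    have h1 : Nat.log 2 x + 1 ≤ r * J := Nat.lt_mul_div_succ (Nat.log 2 x) hr
    calc 2 ^ i * x ≤ 2 ^ i * 2 ^ (Nat.log 2 x + 1) := by
          gcongr; exact (Nat.lt_pow_succ_log_self one_lt_two x).le
      _ ≤ 2 ^ (r * i) * 2 ^ (r * J) := by
          gcongr
          · norm_num
          · exact Nat.le_mul_of_pos_left i hr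
          · norm_num
      _ = 2 ^ (r * (i + J)) := by ring
  have hanti {y : ℝ} {z : ℕ} (hy : 0 < y) (h : y ≤ z) : (z : ℝ) ^ (-s) ≤ y ^ (-s) :=
    Real.rpow_le_rpow_of_nonpos hy h (by linarith)
  have hhead : ∑ j ∈ Finset.range J, ENNReal.ofReal (((x + 2 ^ (r * j) : ℕ) : ℝ) ^ (-s)) ≤
      ENNReal.ofReal ((x : ℝ) ^ (-s) * (Real.logb 2 x / r + 1)) := by
    calc _ ≤ ∑ j ∈ Finset.range J, ENNReal.ofReal ((x : ℝ) ^ (-s)) :=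
          Finset.sum_le_sum fun j _ => ENNReal.ofReal_le_ofReal
            (hanti hx' (by exact_mod_cast Nat.le_add_right _ _))
      _ = ENNReal.ofReal ((x : ℝ) ^ (-s) * J) := by
          rw [Finset.sum_const, Finset.card_range, nsmul_eq_mul, mul_comm,
            ENNReal.ofReal_mul (by positivity), ENNReal.ofReal_natCast]
      _ ≤ _ := by gcongr
  have htail : ∑' i, ENNReal.ofReal (((x + 2 ^ (r * (i + J)) : ℕ) : ℝ) ^ (-s)) ≤
      ENNReal.ofReal ((x : ℝ) ^ (-s) * 2) := by
    calc _ ≤ ∑' i : ℕ, ENNReal.ofReal ((x : ℝ) ^ (-s) * (1 / 2) ^ i) := by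
          refine ENNReal.tsum_le_tsum fun i => ENNReal.ofReal_le_ofReal ?_
          calc ((x + 2 ^ (r * (i + J)) : ℕ) : ℝ) ^ (-s) ≤ ((2 : ℝ) ^ i * x) ^ (-s) :=
                hanti (by positivity) (by exact_mod_cast (hpow i).trans (Nat.le_add_left _ _))
            _ = (x : ℝ) ^ (-s) * ((2 : ℝ) ^ i) ^ (-s) := by
                rw [Real.mul_rpow (by positivity) hx'.le, mul_comm]
            _ ≤ (x : ℝ) ^ (-s) * ((2 : ℝ) ^ i) ^ (-1 : ℝ) := by
                gcongr
                exact one_le_pow₀ one_le_two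
            _ = (x : ℝ) ^ (-s) * (1 / 2) ^ i := by
                rw [Real.rpow_neg_one, one_div, inv_pow]
      _ = ENNReal.ofReal ((x : ℝ) ^ (-s) * 2) := by
          rw [← ENNReal.ofReal_tsum_of_nonneg (fun i => by positivity)
            (summable_geometric_two.mul_left _), tsum_mul_left, tsum_geometric_two]
  rw [← ENNReal.summable.sum_add_tsum_nat_add' (k := J)]
  refine (add_le_add hhead htail).trans_eq ?_
  have hlog : 0 ≤ Real.logb 2 x := Real.logb_nonneg one_lt_two (by exact_mod_cast hx)
  rw [← ENNReal.ofReal_add (by positivity) (by positivity)]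
  congr 1
  ring

open ArithmeticFunction.vonMangoldt in
lemma summable_residueClass_div_rpow {q : ℕ} (a : ZMod q) {x : ℝ} (hx : 1 < x) :
    Summable fun n => residueClass a n / (n : ℝ) ^ x := by
  have h := LSeriesSummable_of_abscissaOfAbsConv_lt_re (s := x)
    ((abscissaOfAbsConv_residueClass_le_one a).trans_lt (by norm_cast))
  refine h.norm.congr fun n => ?_
  rcases eq_or_ne n 0 with rfl | hn
  · simp
  · rw [LSeries.term_of_ne_zero hn, norm_div, Complex.norm_real,
      Real.norm_of_nonneg (residueClass_nonneg a n),
      Complex.norm_natCast_cpow_of_pos (Nat.pos_of_ne_zero hn), Complex.ofReal_re]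

open ArithmeticFunction.vonMangoldt in
lemma tsum_residueClass_upper_bound {q : ℕ} [NeZero q] {a : ZMod q} (ha : IsUnit a) :
    ∃ C : ℝ, ∀ x ∈ Set.Ioc (1 : ℝ) 2,
      ∑' n, residueClass a n / (n : ℝ) ^ x ≤ (q.totient : ℝ)⁻¹ / (x - 1) + C := by
  have H {x : ℝ} (hx : 1 < x) :
      ∑' n, residueClass a n / (n : ℝ) ^ x =
        (LFunctionResidueClassAux a x).re + (q.totient : ℝ)⁻¹ / (x - 1) := by
    refine Complex.ofReal_injective ?_
    push_cast
    simp_rw [Complex.ofReal_cpow (Nat.cast_nonneg _), ← LFunctionResidueClassAux_real ha hx]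
    rw [eqOn_LFunctionResidueClassAux ha (by simpa using hx)]
    simp only [sub_add_cancel, LSeries, LSeries.term, Complex.ofReal_natCast]
    refine tsum_congr fun n => ?_
    split_ifs with hn
    · simp [hn]
    · rfl
  have hcont : ContinuousOn (fun x : ℝ => (LFunctionResidueClassAux a x).re) (Set.Icc 1 2) :=
    Complex.continuous_re.comp_continuousOn <|
      (continuousOn_LFunctionResidueClassAux a).comp Complex.continuous_ofReal.continuousOn
        fun x hx => by simpa using hx.1
  obtain ⟨C, hC⟩ := isCompact_Icc.bddAbove_image hcont
  refine ⟨C, fun x hx => ?_⟩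
  rw [H hx.1, add_comm]
  gcongr
  exact hC (Set.mem_image_of_mem _ (Set.Ioc_subset_Icc_self hx))

lemma rpowSum_range_le (f : ℕ → ℕ) (s : ℝ) :
    rpowSum (Set.range f) s ≤ ∑' j, ENNReal.ofReal ((f j : ℝ) ^ (-s)) :=
  ENNReal.tsum_le_tsum_comp_of_surjective (f := Set.rangeFactorization f)
    Set.rangeFactorization_surjective fun n : Set.range f => ENNReal.ofReal (((n : ℕ) : ℝ) ^ (-s))

lemma rpowSum_iUnion_add_two_pow_le {P : Set ℕ} (hP : ∀ p ∈ P, 0 < p) {r : ℕ} (hr : 0 < r)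
    {s : ℝ} (hs : 1 ≤ s) :
    rpowSum (⋃ p ∈ P, Set.range fun j => p + 2 ^ (r * j)) s ≤
      ∑' p : P, ENNReal.ofReal ((p : ℝ) ^ (-s) * (Real.logb 2 p / r + 3)) :=
  (rpowSum_biUnion_le _ _ _).trans <| ENNReal.tsum_le_tsum fun p =>
    (rpowSum_range_le _ s).trans (tsum_add_two_pow_le (hP p p.2) hr hs)

lemma rpow_neg_le_one (n : ℕ) {s : ℝ} (hs : 0 < s) : (n : ℝ) ^ (-s) ≤ 1 := by
  rcases Nat.eq_zero_or_pos n with rfl | hn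
  · simp [Real.zero_rpow (neg_ne_zero.mpr hs.ne')]
  · exact Real.rpow_le_one_of_one_le_of_nonpos (by exact_mod_cast hn) (by linarith)

lemma exists_rpowSum_iUnion_finset_le {T : Finset ℕ} (hT : ∀ p ∈ T, 0 < p) :
    ∃ K : ℝ, 0 ≤ K ∧ ∀ s : ℝ, 1 < s →
      rpowSum (⋃ p ∈ T, Set.range fun j => p + 2 ^ j) s ≤ ENNReal.ofReal K := by
  have hlog (p : ℕ) : 0 ≤ Real.logb 2 p := by
    rcases Nat.eq_zero_or_pos p with rfl | hp
    · simp
    · exact Real.logb_nonneg one_lt_two (by exact_mod_cast hp)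
  refine ⟨∑ p ∈ T, (Real.logb 2 p + 3),
    Finset.sum_nonneg fun p _ => by linarith [hlog p], fun s hs => ?_⟩
  have h := rpowSum_iUnion_add_two_pow_le (P := T) hT one_pos hs.le
  simp only [one_mul, Finset.mem_coe, Nat.cast_one, div_one] at h
  refine h.trans ?_
  rw [Finset.tsum_subtype' T fun p : ℕ =>
    ENNReal.ofReal ((p : ℝ) ^ (-s) * (Real.logb 2 p + 3)),
    ENNReal.ofReal_sum_of_nonneg fun p _ => by linarith [hlog p]]
  refine Finset.sum_le_sum fun p _ => ENNReal.ofReal_le_ofReal ?_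
  exact mul_le_of_le_one_left (by linarith [hlog p]) (rpow_neg_le_one p (by linarith))

open ArithmeticFunction.vonMangoldt in
lemma exists_rpowSum_primes_add_two_pow_le {q : ℕ} (a : ZMod q) {r : ℕ} (hr : 0 < r) :
    ∃ K : ℝ, 0 ≤ K ∧ ∀ s : ℝ, 1 < s →
      rpowSum (⋃ p ∈ {p : ℕ | p.Prime ∧ (p : ZMod q) = a}, Set.range fun j => p + 2 ^ (r * j)) s ≤
        ENNReal.ofReal (5 / r * ∑' n, residueClass a n / (n : ℝ) ^ s + K) := by
  have hr' : (0 : ℝ) < r := by exact_mod_cast hr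
  set N := ⌈Real.exp r⌉₊
  refine ⟨∑ n ∈ Finset.range N, 3, by positivity, fun s hs => ?_⟩
  have hterm (n : ℕ) : 0 ≤ 5 / r * (residueClass a n / (n : ℝ) ^ s) :=
    mul_nonneg (by positivity) (div_nonneg (residueClass_nonneg a n) (by positivity))
  have hprime {p : ℕ} (hp : p.Prime) (hpa : (p : ZMod q) = a) :
      (p : ℝ) ^ (-s) * (Real.logb 2 p / r + 3) ≤
        5 / r * (residueClass a p / (p : ℝ) ^ s) + if p < N then 3 else 0 := by
    have hp0 : (0 : ℝ) < p := by exact_mod_cast hp.pos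
    have hlog : 0 ≤ Real.log p := Real.log_natCast_nonneg p
    have hres : residueClass a p = Real.log p := by
      rw [residueClass, Set.indicator_of_mem (by exact hpa),
        ArithmeticFunction.vonMangoldt_apply_prime hp]
    have hlogb : Real.logb 2 p / r ≤ 2 * Real.log p / r := by
      gcongr
      rw [Real.logb, div_le_iff₀ (Real.log_pos one_lt_two)]
      nlinarith [Real.log_two_gt_d9]
    have hsmall : (3 : ℝ) * (p : ℝ) ^ (-s) ≤
        (p : ℝ) ^ (-s) * (3 * Real.log p / r) + if p < N then 3 else 0 := by
      split_ifs with hpN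
      · have h1 := rpow_neg_le_one p (by linarith : 0 < s)
        have h2 : 0 ≤ (p : ℝ) ^ (-s) * (3 * Real.log p / r) := by positivity
        linarith
      · have h1 : (r : ℝ) ≤ Real.log p := by
          rw [Real.le_log_iff_exp_le hp0]
          exact (Nat.le_ceil _).trans (by exact_mod_cast not_lt.mp hpN)
        have h2 : 3 ≤ 3 * Real.log p / r := by
          rw [le_div_iff₀ hr']; linarith
        have h3 : 0 ≤ (p : ℝ) ^ (-s) := by positivity
        nlinarith
    have hmain : (p : ℝ) ^ (-s) * (Real.logb 2 p / r) ≤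
        (p : ℝ) ^ (-s) * (2 * Real.log p / r) := by gcongr
    rw [hres, div_eq_mul_inv _ ((p : ℝ) ^ s), ← Real.rpow_neg hp0.le]
    calc _ = (p : ℝ) ^ (-s) * (Real.logb 2 p / r) + 3 * (p : ℝ) ^ (-s) := by ring
      _ ≤ (p : ℝ) ^ (-s) * (2 * Real.log p / r) +
          ((p : ℝ) ^ (-s) * (3 * Real.log p / r) + if p < N then 3 else 0) :=
        add_le_add hmain hsmall
      _ = _ := by ring
  have hfinite : ∑' n, ENNReal.ofReal (if n < N then 3 else 0) =
      ENNReal.ofReal (∑ n ∈ Finset.range N, 3) := by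
    rw [tsum_eq_sum (s := Finset.range N) fun n hn => by
        simp [not_lt.mpr (not_lt.mp (Finset.mem_range.not.mp hn))],
      ENNReal.ofReal_sum_of_nonneg fun _ _ => by norm_num]
    exact Finset.sum_congr rfl fun n hn => by simp_all
  calc _ ≤ ∑' p : {p : ℕ | p.Prime ∧ (p : ZMod q) = a},
          ENNReal.ofReal ((p : ℝ) ^ (-s) * (Real.logb 2 p / r + 3)) :=
        rpowSum_iUnion_add_two_pow_le (fun p hp => hp.1.pos) hr hs.le
    _ ≤ ∑' p : {p : ℕ | p.Prime ∧ (p : ZMod q) = a},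
          ENNReal.ofReal (5 / r * (residueClass a p / (p : ℝ) ^ s) + if (p : ℕ) < N then 3 else 0) :=
        ENNReal.tsum_le_tsum fun p => ENNReal.ofReal_le_ofReal (hprime p.2.1 p.2.2)
    _ ≤ ∑' n : ℕ,
          ENNReal.ofReal (5 / r * (residueClass a n / (n : ℝ) ^ s) + if n < N then 3 else 0) :=
        ENNReal.tsum_comp_le_tsum_of_injective Subtype.val_injective fun n : ℕ =>
          ENNReal.ofReal (5 / r * (residueClass a n / (n : ℝ) ^ s) + if n < N then 3 else 0)
    _ = ∑' n : ℕ, ENNReal.ofReal (5 / r * (residueClass a n / (n : ℝ) ^ s)) +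
          ∑' n, ENNReal.ofReal (if n < N then 3 else 0) := by
        rw [← ENNReal.tsum_add]
        exact tsum_congr fun n => ENNReal.ofReal_add (hterm n) (by positivity)
    _ = _ := by
        rw [hfinite, ← ENNReal.ofReal_tsum_of_nonneg hterm
          ((summable_residueClass_div_rpow a hs).mul_left _), tsum_mul_left,
          ENNReal.ofReal_add (by rw [← tsum_mul_left]; exact tsum_nonneg hterm) (by positivity)]

/-- If a residue class modulo `M` is covered by a set of density zero, the numbers `p + 2 ^ k` with
`p` in a finite set, and the numbers `p + 2 ^ k` with `p` a prime in an invertible residue class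
modulo `q` and `r ∣ k`, then `M` cannot be small compared to `r * φ(q)`. -/
lemma inv_modulus_le {M c q r : ℕ} [NeZero q] {a : ZMod q} (ha : IsUnit a) (hM : 0 < M)
    (hr : 0 < r) {W : Set ℕ} (hW : DensityZero W) {T : Finset ℕ} (hT : ∀ p ∈ T, 0 < p)
    (hcover : ∀ n, n ≡ c [MOD M] → n ∈ W ∨ ∃ p k, n = p + 2 ^ k ∧
      (p ∈ T ∨ p.Prime ∧ (p : ZMod q) = a ∧ r ∣ k)) :
    (M : ℝ)⁻¹ ≤ 5 / r * (q.totient : ℝ)⁻¹ := by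
  have hr' : (0 : ℝ) < r := by exact_mod_cast hr
  obtain ⟨K₁, hK₁, h₁⟩ := exists_rpowSum_iUnion_finset_le hT
  obtain ⟨K₂, hK₂, h₂⟩ := exists_rpowSum_primes_add_two_pow_le a hr
  obtain ⟨C, hC⟩ := tsum_residueClass_upper_bound ha
  set A := ⋃ p ∈ T, Set.range fun j => p + 2 ^ j
  set B := ⋃ p ∈ {p : ℕ | p.Prime ∧ (p : ZMod q) = a}, Set.range fun j => p + 2 ^ (r * j)
  have hsub : {n | n ≡ c [MOD M]} ⊆ W ∪ (A ∪ B) := by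
    intro n hn
    rcases hcover n hn with h | ⟨p, k, rfl, hp | ⟨hp, hpa, j, rfl⟩⟩
    · exact .inl h
    · exact .inr (.inl (Set.mem_biUnion (x := p) hp ⟨k, rfl⟩))
    · exact .inr (.inr (Set.mem_biUnion (x := p) ⟨hp, hpa⟩ ⟨j, rfl⟩))
  have hbound : ∀ s ∈ Set.Ioc (1 : ℝ) 2,
      (s - 1) * (rpowSum {n | n ≡ c [MOD M]} s).toReal ≤
        (s - 1) * (rpowSum W s).toReal +
          (5 / r * (q.totient : ℝ)⁻¹ + (s - 1) * (K₁ + K₂ + 5 / r * C)) := by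
    intro s hs
    have hs1 : 0 < s - 1 := sub_pos.mpr hs.1
    set R := ∑' n, ArithmeticFunction.vonMangoldt.residueClass a n / (n : ℝ) ^ s
    have hR : 0 ≤ R := tsum_nonneg fun n =>
      div_nonneg (ArithmeticFunction.vonMangoldt.residueClass_nonneg a n) (by positivity)
    have hsum : rpowSum {n | n ≡ c [MOD M]} s ≤
        rpowSum W s + ENNReal.ofReal (K₁ + (5 / r * R + K₂)) := by
      rw [ENNReal.ofReal_add hK₁ (by positivity)]
      calc _ ≤ rpowSum (W ∪ (A ∪ B)) s := rpowSum_mono hsub s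
        _ ≤ rpowSum W s + rpowSum (A ∪ B) s := rpowSum_union_le _ _ s
        _ ≤ rpowSum W s + (rpowSum A s + rpowSum B s) := by
            gcongr; exact rpowSum_union_le _ _ s
        _ ≤ _ := by gcongr; exacts [h₁ s hs.1, h₂ s hs.1]
    have hreal := ENNReal.toReal_mono
      (ENNReal.add_ne_top.mpr ⟨rpowSum_ne_top W hs.1, ENNReal.ofReal_ne_top⟩) hsum
    rw [ENNReal.toReal_add (rpowSum_ne_top W hs.1) ENNReal.ofReal_ne_top,
      ENNReal.toReal_ofReal (by positivity)] at hreal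
    calc _ ≤ (s - 1) * ((rpowSum W s).toReal +
          (K₁ + (5 / r * ((q.totient : ℝ)⁻¹ / (s - 1) + C) + K₂))) := by
          gcongr
          refine hreal.trans ?_
          gcongr
          exact hC s hs
      _ = _ := by field_simp; ring
  have hlim : Tendsto (fun s : ℝ => (s - 1) * (rpowSum W s).toReal +
      (5 / r * (q.totient : ℝ)⁻¹ + (s - 1) * (K₁ + K₂ + 5 / r * C))) (𝓝[>] 1)
      (𝓝 (0 + (5 / r * (q.totient : ℝ)⁻¹ + (1 - 1) * (K₁ + K₂ + 5 / r * C)))) :=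
    (tendsto_sub_mul_rpowSum hW).add
      ((Continuous.tendsto (by fun_prop) 1).mono_left nhdsWithin_le_nhds)
  simp only [sub_self, zero_mul, add_zero, zero_add] at hlim
  refine le_of_tendsto_of_tendsto (tendsto_sub_mul_rpowSum (tendsto_card_modEq_div hM c)) hlim ?_
  filter_upwards [Ioc_mem_nhdsGT one_lt_two] with s hs using hbound s hs

/-- The least prime factor of the `i`-th Fermat number. -/
def fermatFactor (i : ℕ) : ℕ := (Nat.fermatNumber i).minFac

lemma fermatFactor_dvd (i : ℕ) : fermatFactor i ∣ Nat.fermatNumber i := Nat.minFac_dvd _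

lemma prime_fermatFactor (i : ℕ) : (fermatFactor i).Prime :=
  Nat.minFac_prime (Nat.fermatNumber_ne_one i)

lemma odd_fermatFactor (i : ℕ) : Odd (fermatFactor i) :=
  (Nat.odd_fermatNumber i).of_dvd_nat (fermatFactor_dvd i)

lemma prod_fermatFactor_dvd (I : ℕ) : ∏ i ∈ Finset.range I, fermatFactor i ∣ 2 ^ 2 ^ I - 1 := by
  have h : ∏ i ∈ Finset.range I, fermatFactor i ∣ Nat.fermatNumber I - 2 := by
    rw [← Nat.prod_fermatNumber]
    exact Finset.prod_dvd_prod_of_dvd _ _ fun i _ => fermatFactor_dvd i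
  simpa [Nat.fermatNumber] using h

lemma odd_prod_fermatFactor (I : ℕ) : Odd (∏ i ∈ Finset.range I, fermatFactor i) :=
  Finset.prod_induction _ Odd (fun _ _ => Odd.mul) odd_one fun i _ => odd_fermatFactor i

lemma two_pow_mul_prod_fermatFactor_le (I : ℕ) :
    2 ^ I * ∏ i ∈ Finset.range I, fermatFactor i ≤
      3 ^ I * (∏ i ∈ Finset.range I, fermatFactor i).totient := by
  induction I with
  | zero => simp
  | succ I ih =>
    have hcop : (∏ i ∈ Finset.range I, fermatFactor i).Coprime (fermatFactor I) :=
      Nat.Coprime.prod_left fun i hi =>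
        ((Nat.coprime_fermatNumber_fermatNumber (Finset.mem_range.mp hi).ne).coprime_dvd_left
          (fermatFactor_dvd i)).coprime_dvd_right (fermatFactor_dvd I)
    rw [Finset.prod_range_succ, Nat.totient_mul hcop, Nat.totient_prime (prime_fermatFactor I)]
    have h3 : 2 * fermatFactor I ≤ 3 * (fermatFactor I - 1) := by
      have h2 := (prime_fermatFactor I).two_le
      obtain ⟨k, hk⟩ := odd_fermatFactor I
      omega
    calc _ = (2 ^ I * ∏ i ∈ Finset.range I, fermatFactor i) * (2 * fermatFactor I) := by ring
      _ ≤ (3 ^ I * (∏ i ∈ Finset.range I, fermatFactor i).totient) *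
          (3 * (fermatFactor I - 1)) := Nat.mul_le_mul ih h3
      _ = _ := by ring

lemma exists_fermatFactor_dvd {I k : ℕ} (hk : ¬ 2 ^ I ∣ k) :
    ∃ i < I, fermatFactor i ∣ 2 ^ k + 1 := by
  obtain ⟨i, l, hl, rfl⟩ := Nat.exists_eq_two_pow_mul_odd (n := k) (by rintro rfl; simp at hk)
  refine ⟨i, ?_, (fermatFactor_dvd i).trans ?_⟩
  · by_contra! h
    exact hk ((pow_dvd_pow 2 h).mul_right l)
  · rw [pow_mul]
    simpa [Nat.fermatNumber] using hl.nat_add_dvd_pow_add_pow (2 ^ 2 ^ i) 1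

lemma two_pow_eq_one_of_two_pow_dvd {I k : ℕ} (hk : 2 ^ I ∣ k) :
    (2 : ZMod (∏ i ∈ Finset.range I, fermatFactor i)) ^ k = 1 := by
  obtain ⟨l, rfl⟩ := hk
  have h := (ZMod.natCast_eq_zero_iff _ _).mpr (prod_fermatFactor_dvd I)
  rw [Nat.cast_sub Nat.one_le_two_pow] at h
  push_cast at h
  rw [pow_mul, sub_eq_zero.mp h, one_pow]

/-- A progression one of whose terms is congruent to `u + 2 ^ k` modulo its difference, with `u`
coprime to the difference, is not contained in `U`. -/
lemma not_AP_subset_U {m a n u k : ℕ} (hm : 0 < m) (hk : 0 < k) (hn : n ∈ AP m a)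
    (hnu : n ≡ u + 2 ^ k [MOD m]) (hu : u.Coprime m) : ¬ AP m a ⊆ U := by
  intro hsub
  obtain ⟨p, hpn, hp, hpu⟩ := Nat.forall_exists_prime_gt_and_modEq n hm.ne' hu
  obtain ⟨h, rfl⟩ := hn
  have hmod : m * h + a ≡ p + 2 ^ k [MOD m] := hnu.trans (hpu.symm.add_right _)
  have hle : m * h + a ≤ p + 2 ^ k := hpn.le.trans (Nat.le_add_right _ _)
  obtain ⟨l, hl⟩ := (Nat.modEq_iff_dvd' hle).mp hmod
  have hmem : p + 2 ^ k ∈ AP m a := ⟨h + l, by rw [mul_add]; omega⟩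
  exact (hsub hmem).2.2 ⟨p, k, hp, hk, rfl⟩

theorem stmt1 :
    ¬ ∃ (t : ℕ) (m a : Fin t → ℕ) (W : Set ℕ),
      (∀ i, 0 < m i) ∧ (∀ i, 0 < a i) ∧ (∀ n ∈ W, 0 < n) ∧ DensityZero W ∧
      U = (⋃ i, AP (m i) (a i)) ∪ W := by
  rintro ⟨t, m, a, W, hm, -, -, hW, hU⟩
  set D := ∏ i, m i
  have hD : 0 < D := Finset.prod_pos fun i _ => hm i
  obtain ⟨I, hI⟩ := pow_unbounded_of_one_lt (10 * D : ℝ) (by norm_num : (1 : ℝ) < 4 / 3)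
  set Q := ∏ i ∈ Finset.range I, fermatFactor i
  have hQ : 0 < Q := (odd_prod_fermatFactor I).pos
  have : NeZero Q := ⟨hQ.ne'⟩
  have hunit : IsUnit (-2 : ZMod Q) := by
    rw [IsUnit.neg_iff]
    exact_mod_cast (ZMod.isUnit_iff_coprime 2 Q).mpr (odd_prod_fermatFactor I).coprime_two_left
  set M := 2 * D * Q
  have hM : 0 < M := by positivity
  obtain ⟨u, huM, hu, huQ⟩ := Nat.forall_exists_prime_gt_and_eq_mod hunit M
  have hdvd (i : Fin t) : m i ∣ M :=
    (Finset.dvd_prod_of_mem m (Finset.mem_univ i)).trans ⟨2 * Q, by simp only [M, D]; ring⟩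
  have hcover : ∀ n, n ≡ u + 2 ^ 2 ^ I [MOD M] → n ∈ W ∨ ∃ p k, n = p + 2 ^ k ∧
      (p ∈ (Finset.range I).image fermatFactor ∨
        p.Prime ∧ (p : ZMod Q) = -2 ∧ 2 ^ I ∣ k) := by
    intro n hn
    have hnodd : Odd n := by
      have h2 : n ≡ u + 2 ^ 2 ^ I [MOD 2] := hn.of_dvd ⟨D * Q, by simp only [M]; ring⟩
      have hsum : Odd (u + 2 ^ 2 ^ I) := (hu.odd_of_ne_two (by grind)).add_even
        (even_two.pow_of_ne_zero (by positivity))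
      exact Nat.odd_iff.mpr (Eq.trans h2 (Nat.odd_iff.mp hsum))
    have hnQ : (n : ZMod Q) = -1 := by
      rw [(ZMod.natCast_eq_natCast_iff _ _ _).mpr (hn.of_dvd ⟨2 * D, by simp only [M]; ring⟩)]
      push_cast
      rw [huQ, two_pow_eq_one_of_two_pow_dvd dvd_rfl]
      norm_num
    by_cases hnU : n ∈ U
    · left
      rw [hU] at hnU
      refine hnU.resolve_left fun hmem => ?_
      obtain ⟨i, hi⟩ := Set.mem_iUnion.mp hmem
      refine not_AP_subset_U (hm i) (by positivity : 0 < 2 ^ I) hi (hn.of_dvd (hdvd i)) ?_ ?_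
      · refine Nat.coprime_of_lt_prime (hm i).ne' ?_ hu
        exact (Nat.le_of_dvd hM (hdvd i)).trans_lt huM
      · rw [hU]
        exact (Set.subset_iUnion (fun i => AP (m i) (a i)) i).trans Set.subset_union_left
    · right
      obtain ⟨p, k, hp, hk, rfl⟩ : ∃ p k : ℕ, p.Prime ∧ 0 < k ∧ n = p + 2 ^ k := by
        by_contra h
        exact hnU ⟨hnodd.pos, hnodd, h⟩
      refine ⟨p, k, rfl, ?_⟩
      push_cast at hnQ
      by_cases hIk : 2 ^ I ∣ k
      · refine .inr ⟨hp, ?_, hIk⟩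
        rw [two_pow_eq_one_of_two_pow_dvd hIk] at hnQ
        linear_combination hnQ
      · left
        obtain ⟨i, hi, hik⟩ := exists_fermatFactor_dvd hIk
        have hQn : Q ∣ p + (2 ^ k + 1) := by
          rw [← ZMod.natCast_eq_zero_iff]
          push_cast
          linear_combination hnQ
        have hip : fermatFactor i ∣ p := (Nat.dvd_add_left hik).mp
          ((Finset.dvd_prod_of_mem fermatFactor (Finset.mem_range.mpr hi)).trans hQn)
        rw [← (Nat.prime_dvd_prime_iff_eq (prime_fermatFactor i) hp).mp hip]
        exact Finset.mem_image_of_mem _ (Finset.mem_range.mpr hi)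
  have hT : ∀ p ∈ (Finset.range I).image fermatFactor, 0 < p := by
    simp only [Finset.mem_image]
    rintro _ ⟨i, -, rfl⟩
    exact (prime_fermatFactor i).pos
  have hle := inv_modulus_le hunit hM (by positivity : 0 < 2 ^ I) hW hT hcover
  have hφ : (0 : ℝ) < Q.totient := by exact_mod_cast Nat.totient_pos.mpr hQ
  have hQ' : (0 : ℝ) < Q := by exact_mod_cast hQ
  have hD' : (0 : ℝ) < D := by exact_mod_cast hD
  have htot : (2 : ℝ) ^ I * Q ≤ 3 ^ I * Q.totient := by
    exact_mod_cast two_pow_mul_prod_fermatFactor_le I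
  have hle' : (2 : ℝ) ^ I * Q.totient ≤ 10 * D * Q := by
    simp only [M] at hle
    push_cast at hle
    field_simp at hle
    linarith
  rw [div_pow, lt_div_iff₀ (by positivity)] at hI
  have h4 : (4 : ℝ) ^ I = 2 ^ I * 2 ^ I := by rw [← mul_pow]; norm_num
  have h1 := mul_lt_mul_of_pos_right hI hQ'
  have h2 := mul_le_mul_of_nonneg_left htot (by positivity : (0 : ℝ) ≤ 2 ^ I)
  have h3 := mul_le_mul_of_nonneg_left hle' (by positivity : (0 : ℝ) ≤ 3 ^ I)
  rw [h4] at h1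
  linarith
end
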